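/- arXiv:2505.03577 — 3 statements merged into one kernel-verified Lean document; each statement's English description precedes it below -/
import Mathlib

section
/- Orthogonal approximation, first bound (Lemma B.1, eq. (approx1)). Let ψ ∈ C²(ℝ) be odd with bounded first and second derivatives, and let g₂ ∈ C¹(ℝ) be such that g₂ and g₂′ have at most polynomial growth. Let (z₁, z₂) be a centered jointly Gaussian pair with covariances C_{ij} = E z_i z_j (C₂₂ > 0) and set Δ₁₂ = C₁₂/C₂₂. Then there exists a constant L₁ > 0 depending only on ψ, g₂ and the variances C₁₁, C₂₂ such that |E[ψ(z₁)g₂(z₂)] − C₁₂ · E[ψ′(z₁)] · E[g₂′(z₂)]| ≤ L₁ Δ₁₂². -/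
open MeasureTheory ProbabilityTheory

noncomputable section

/-- Standard Gaussian measure on `ℝ`. -/
def stdG : Measure ℝ := gaussianReal 0 1

/-- First coordinate of a centered bivariate Gaussian pair with covariance matrix
`(C11, C12; C12, C22)`, realised from two i.i.d. standard Gaussians. -/
def gaussZ1 (C11 C12 C22 : ℝ) (g : ℝ × ℝ) : ℝ :=
  (C12 / Real.sqrt C22) * g.2 + Real.sqrt (C11 - C12 ^ 2 / C22) * g.1

/-- Second coordinate of the pair. -/
def gaussZ2 (C22 : ℝ) (g : ℝ × ℝ) : ℝ := Real.sqrt C22 * g.2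

/-- Functions of at most polynomial growth, times monomials, are integrable for the standard
Gaussian. -/
lemma integrable_pow_mul_comp_mul_stdG {f : ℝ → ℝ} (hf : Continuous f) {c : ℝ} {q : ℕ}
    (hfc : ∀ x, |f x| ≤ c * (1 + |x| ^ q)) (k : ℕ) (s : ℝ) :
    Integrable (fun x ↦ x ^ k * f (s * x)) stdG := by
  have hmoment (n : ℕ) : Integrable (fun x : ℝ ↦ |x| ^ n) stdG := by
    have h := (memLp_id_gaussianReal (μ := 0) (v := 1) n).integrable_norm_pow'
    simpa [stdG] using h
  refine (((hmoment k).add ((hmoment (k + q)).const_mul (|s| ^ q))).const_mul c).mono'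
    (by fun_prop) (ae_of_all _ fun x ↦ ?_)
  calc ‖x ^ k * f (s * x)‖ = |x| ^ k * |f (s * x)| := by simp
    _ ≤ |x| ^ k * (c * (1 + |s * x| ^ q)) := by gcongr; exact hfc _
    _ = _ := by simp only [Pi.add_apply, abs_mul, mul_pow, pow_add]; ring

lemma hasDerivAt_gaussianPDFReal_zero_one (x : ℝ) :
    HasDerivAt (gaussianPDFReal 0 1) (-x * gaussianPDFReal 0 1 x) x := by
  have h : HasDerivAt (fun y : ℝ ↦ -(y - 0) ^ 2 / (2 * ((1 : NNReal) : ℝ))) (-x) x := by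
    convert! ((((hasDerivAt_id x).sub_const 0).pow 2).neg).div_const
      (2 * ((1 : NNReal) : ℝ)) using 1
    norm_num
    ring
  convert! h.exp.const_mul ((√(2 * Real.pi * ((1 : NNReal) : ℝ)))⁻¹) using 1
  simp only [gaussianPDFReal]
  ring

lemma integrable_stdG_iff {f : ℝ → ℝ} :
    Integrable f stdG ↔ Integrable fun x ↦ gaussianPDFReal 0 1 x * f x := by
  rw [stdG, gaussianReal_of_var_ne_zero _ one_ne_zero,
    integrable_withDensity_iff_integrable_smul' (measurable_gaussianPDF 0 1)
      (ae_of_all _ fun _ ↦ gaussianPDF_lt_top)]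
  simp

/-- Gaussian integration by parts (Stein's lemma). -/
lemma integral_mul_stdG_eq_integral_deriv {u u' : ℝ → ℝ} (hu : ∀ x, HasDerivAt u (u' x) x)
    (hi : Integrable u stdG) (hi' : Integrable u' stdG)
    (hxi : Integrable (fun x ↦ x * u x) stdG) :
    ∫ x, x * u x ∂stdG = ∫ x, u' x ∂stdG := by
  rw [integrable_stdG_iff] at hi hi' hxi
  have h := integral_mul_deriv_eq_deriv_mul_of_integrable (u := u) (u' := u')
    (v := gaussianPDFReal 0 1) (v' := fun x ↦ -x * gaussianPDFReal 0 1 x)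
    (fun x _ ↦ hu x) (fun x _ ↦ hasDerivAt_gaussianPDFReal_zero_one x)
    (hxi.neg.congr (ae_of_all _ fun x ↦ by simp only [Pi.neg_apply, Pi.mul_apply]; ring))
    (hi'.congr (ae_of_all _ fun x ↦ by simp only [Pi.mul_apply]; ring))
    (hi.congr (ae_of_all _ fun x ↦ by simp only [Pi.mul_apply]; ring))
  rw [stdG, integral_gaussianReal_eq_integral_smul one_ne_zero,
    integral_gaussianReal_eq_integral_smul one_ne_zero]
  calc ∫ x, gaussianPDFReal 0 1 x • (x * u x)
      = -∫ x, u x * (-x * gaussianPDFReal 0 1 x) := by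
        rw [← integral_neg]; congr with x; simp only [smul_eq_mul]; ring
    _ = ∫ x, gaussianPDFReal 0 1 x • u' x := by
        rw [h, neg_neg]; congr with x; simp only [smul_eq_mul]; ring

/-- Odd functions are centered under the standard Gaussian. -/
lemma integral_stdG_eq_zero_of_odd {f : ℝ → ℝ} (hf : ∀ x, f (-x) = -f x) :
    ∫ x, f x ∂stdG = 0 := by
  have hmap : stdG.map (fun x ↦ -x) = stdG := by simp [stdG, gaussianReal_map_neg]
  have h : ∫ x, f x ∂stdG = ∫ x, f (-x) ∂stdG := by
    conv_lhs => rw [← hmap]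
    exact integral_map_equiv (MeasurableEquiv.neg ℝ) f
  simp only [hf, integral_neg] at h
  linarith

lemma abs_deriv_add_sub_le {ψ : ℝ → ℝ} (hψ : ContDiff ℝ 2 ψ) {K : ℝ}
    (hK : ∀ x, |deriv (deriv ψ) x| ≤ K) (u h : ℝ) :
    |deriv ψ (u + h) - deriv ψ u| ≤ K * |h| := by
  have hd : Differentiable ℝ (deriv ψ) :=
    (hψ.deriv' (n := 1)).differentiable one_ne_zero
  simpa using convex_univ.norm_image_sub_le_of_norm_deriv_le (fun x _ ↦ hd x)
    (fun x _ ↦ hK x) (Set.mem_univ u) (Set.mem_univ (u + h))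

/-- First-order Taylor expansion with quadratic remainder. -/
lemma abs_add_sub_sub_deriv_mul_le {ψ : ℝ → ℝ} (hψ : ContDiff ℝ 2 ψ) {K : ℝ}
    (hK : ∀ x, |deriv (deriv ψ) x| ≤ K) (u h : ℝ) :
    |ψ (u + h) - ψ u - deriv ψ u * h| ≤ K * h ^ 2 := by
  have hK0 : 0 ≤ K := (abs_nonneg _).trans (hK 0)
  have hd : Differentiable ℝ ψ := hψ.differentiable two_ne_zero
  have hD (t : ℝ) : HasDerivAt (fun t ↦ ψ (u + t) - deriv ψ u * t)
      (deriv ψ (u + t) - deriv ψ u) t := by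
    convert! ((hd (u + t)).hasDerivAt.comp_const_add u t).sub
      ((hasDerivAt_id t).const_mul (deriv ψ u)) using 1
    simp
  have hb : ∀ t ∈ Set.uIcc 0 h, ‖deriv ψ (u + t) - deriv ψ u‖ ≤ K * |h| := fun t ht ↦ by
    refine (abs_deriv_add_sub_le hψ hK u t).trans (mul_le_mul_of_nonneg_left ?_ hK0)
    simpa using Set.abs_sub_left_of_mem_uIcc ht
  have h' := (convex_uIcc 0 h).norm_image_sub_le_of_norm_hasDerivWithin_le
    (fun t _ ↦ (hD t).hasDerivWithinAt) hb Set.left_mem_uIcc Set.right_mem_uIcc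
  calc |ψ (u + h) - ψ u - deriv ψ u * h|
      = ‖ψ (u + h) - deriv ψ u * h - (ψ (u + 0) - deriv ψ u * 0)‖ := by
        rw [Real.norm_eq_abs]; congr 1; simp only [add_zero]; ring
    _ ≤ K * |h| * ‖h - 0‖ := h'
    _ = K * h ^ 2 := by rw [sub_zero, Real.norm_eq_abs, mul_assoc, abs_mul_abs_self, sq]

instance inst_s5 : IsProbabilityMeasure stdG := by unfold stdG; infer_instance

/-- Decoupling bound for a smooth odd function of a weakly correlated Gaussian combination. -/
lemma abs_integral_mul_sub_le {ψ g : ℝ → ℝ} (hψ : ContDiff ℝ 2 ψ)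
    (hψodd : ∀ x, ψ (-x) = -ψ x) {K : ℝ} (hK₁ : ∀ x, |deriv ψ x| ≤ K)
    (hK₂ : ∀ x, |deriv (deriv ψ) x| ≤ K) (hg : ContDiff ℝ 1 g) {c : ℝ} {q : ℕ}
    (hgc : ∀ x, |g x| ≤ c * (1 + |x| ^ q)) (hgc' : ∀ x, |deriv g x| ≤ c * (1 + |x| ^ q))
    (a b s : ℝ) :
    |(∫ p : ℝ × ℝ, ψ (a * p.2 + b * p.1) * g (s * p.2) ∂(stdG.prod stdG)) -
        a * s * (∫ p : ℝ × ℝ, deriv ψ (a * p.2 + b * p.1) ∂(stdG.prod stdG)) *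
          (∫ y, deriv g (s * y) ∂stdG)| ≤
      (K * (∫ y, y ^ 2 * |g (s * y)| ∂stdG) +
        |s| * (K * (∫ y, |y| ∂stdG)) * |∫ y, deriv g (s * y) ∂stdG|) * a ^ 2 := by
  have hK0 : 0 ≤ K := (abs_nonneg _).trans (hK₁ 0)
  have hψc : Continuous ψ := hψ.continuous
  have hψc' : Continuous (deriv ψ) := hψ.continuous_deriv (by norm_num)
  have hgcont : Continuous g := hg.continuous
  have hgcont' : Continuous (deriv g) := hg.continuous_deriv le_rfl
  have hψ0 : ψ 0 = 0 := by have := hψodd 0; rw [neg_zero] at this; linarith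
  have hψlin (x : ℝ) : |ψ x| ≤ K * (1 + |x| ^ 1) := by
    have h : |ψ x| ≤ K * |x| := by
      simpa [hψ0] using convex_univ.norm_image_sub_le_of_norm_deriv_le
        (fun x _ ↦ hψ.differentiable two_ne_zero x) (fun x _ ↦ hK₁ x)
        (Set.mem_univ 0) (Set.mem_univ x)
    rw [pow_one]; linarith
  have iψ : Integrable (fun x ↦ ψ (b * x)) stdG := by
    simpa using integrable_pow_mul_comp_mul_stdG hψc hψlin 0 b
  have iψ' : Integrable (fun x ↦ deriv ψ (b * x)) stdG :=
    Integrable.of_bound (by fun_prop) K (ae_of_all _ fun x ↦ hK₁ _)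
  have ig : Integrable (fun y ↦ g (s * y)) stdG := by
    simpa using integrable_pow_mul_comp_mul_stdG hgcont hgc 0 s
  have iyg : Integrable (fun y ↦ y * g (s * y)) stdG := by
    simpa using integrable_pow_mul_comp_mul_stdG hgcont hgc 1 s
  have ig' : Integrable (fun y ↦ deriv g (s * y)) stdG := by
    simpa using integrable_pow_mul_comp_mul_stdG hgcont' hgc' 0 s
  have iy2g : Integrable (fun y ↦ y ^ 2 * |g (s * y)|) stdG :=
    (integrable_pow_mul_comp_mul_stdG hgcont hgc 2 s).norm.congr
      (ae_of_all _ fun y ↦ by simp)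
  have iy : Integrable (fun y : ℝ ↦ |y|) stdG := by
    have h := integrable_pow_mul_comp_mul_stdG (f := fun _ ↦ 1) continuous_const (c := 1) (q := 0)
      (fun _ ↦ by norm_num) 1 0
    simpa using h.norm
  set E := ∫ y, deriv g (s * y) ∂stdG with hE
  have hstein : ∫ y, y * g (s * y) ∂stdG = s * E := by
    rw [hE, ← integral_const_mul]
    refine integral_mul_stdG_eq_integral_deriv (fun y ↦ ?_) ig (ig'.const_mul s) iyg
    have h := ((hg.differentiable one_ne_zero (s * y)).hasDerivAt).comp y
      ((hasDerivAt_id y).const_mul s)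
    simpa [Function.comp_def, mul_comm] using h
  have hzero : ∫ x, ψ (b * x) ∂stdG = 0 :=
    integral_stdG_eq_zero_of_odd fun x ↦ by rw [mul_neg, hψodd]
  set μ := stdG.prod stdG with hμ
  have i₀ : Integrable (fun p : ℝ × ℝ ↦ ψ (b * p.1) * g (s * p.2)) μ := iψ.mul_prod ig
  have i₁ : Integrable (fun p : ℝ × ℝ ↦ deriv ψ (b * p.1) * (p.2 * g (s * p.2))) μ :=
    iψ'.mul_prod iyg
  have iB : Integrable (fun p : ℝ × ℝ ↦ K * a ^ 2 * (p.2 ^ 2 * |g (s * p.2)|)) μ :=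
    (iy2g.comp_snd stdG).const_mul _
  set R : ℝ × ℝ → ℝ := fun p ↦
    (ψ (b * p.1 + a * p.2) - ψ (b * p.1) - deriv ψ (b * p.1) * (a * p.2)) * g (s * p.2) with hR
  have hRb (p : ℝ × ℝ) : ‖R p‖ ≤ K * a ^ 2 * (p.2 ^ 2 * |g (s * p.2)|) := by
    rw [hR, norm_mul, Real.norm_eq_abs, Real.norm_eq_abs]
    calc _ ≤ K * (a * p.2) ^ 2 * |g (s * p.2)| := by
          gcongr; exact abs_add_sub_sub_deriv_mul_le hψ hK₂ _ _
      _ = _ := by ring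
  have iR : Integrable R μ := iB.mono' (by fun_prop) (ae_of_all _ hRb)
  have hRle : |∫ p, R p ∂μ| ≤ K * a ^ 2 * ∫ y, y ^ 2 * |g (s * y)| ∂stdG := by
    refine (norm_integral_le_of_norm_le iB (ae_of_all _ hRb)).trans_eq ?_
    rw [integral_const_mul, hμ, integral_fun_snd (fun y ↦ y ^ 2 * |g (s * y)|)]
    simp
  have hmain : ∫ p : ℝ × ℝ, ψ (a * p.2 + b * p.1) * g (s * p.2) ∂μ =
      a * s * (∫ x, deriv ψ (b * x) ∂stdG) * E + ∫ p, R p ∂μ := by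
    calc _ = ∫ p : ℝ × ℝ, (ψ (b * p.1) * g (s * p.2) +
            a * (deriv ψ (b * p.1) * (p.2 * g (s * p.2)))) + R p ∂μ := by
          congr with p; rw [hR, add_comm (a * p.2)]; ring
      _ = _ := by
          rw [integral_add (by exact i₀.add (i₁.const_mul a)) iR, integral_add i₀ (i₁.const_mul a),
            integral_const_mul, hμ, integral_prod_mul (fun x ↦ ψ (b * x)) (fun y ↦ g (s * y)),
            integral_prod_mul (fun x ↦ deriv ψ (b * x)) (fun y ↦ y * g (s * y)),
            hstein, hzero]
          ring
  have iD : Integrable (fun p : ℝ × ℝ ↦ deriv ψ (a * p.2 + b * p.1)) μ :=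
    Integrable.of_bound (by fun_prop) K (ae_of_all _ fun p ↦ hK₁ _)
  have hDle : |(∫ x, deriv ψ (b * x) ∂stdG) - ∫ p : ℝ × ℝ, deriv ψ (a * p.2 + b * p.1) ∂μ| ≤
      K * |a| * ∫ y, |y| ∂stdG := by
    have e : ∫ x, deriv ψ (b * x) ∂stdG = ∫ p : ℝ × ℝ, deriv ψ (b * p.1) ∂μ := by
      rw [hμ, integral_fun_fst (fun x ↦ deriv ψ (b * x))]; simp
    rw [e, ← integral_sub (iψ'.comp_fst stdG) iD]
    rw [← Real.norm_eq_abs]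
    refine (norm_integral_le_of_norm_le ((iy.comp_snd stdG).const_mul (K * |a|))
      (ae_of_all _ fun p ↦ ?_)).trans_eq ?_
    · rw [norm_sub_rev, add_comm (a * p.2), Real.norm_eq_abs, mul_assoc, ← abs_mul]
      exact abs_deriv_add_sub_le hψ hK₂ _ _
    · rw [integral_const_mul, integral_fun_snd (fun y : ℝ ↦ |y|)]
      simp
  rw [hmain]
  set D₀ := ∫ x, deriv ψ (b * x) ∂stdG
  set D := ∫ p : ℝ × ℝ, deriv ψ (a * p.2 + b * p.1) ∂μ
  calc _ = |(∫ p, R p ∂μ) + a * s * (D₀ - D) * E| := by congr 1; ring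
    _ ≤ |∫ p, R p ∂μ| + |a| * |s| * |D₀ - D| * |E| := by
        simpa only [abs_mul] using abs_add_le (∫ p, R p ∂μ) (a * s * (D₀ - D) * E)
    _ ≤ K * a ^ 2 * (∫ y, y ^ 2 * |g (s * y)| ∂stdG) +
          |a| * |s| * (K * |a| * ∫ y, |y| ∂stdG) * |E| := by gcongr
    _ = _ := by rw [← sq_abs a]; ring

/-- **Lemma B.1, eq. (approx1) (Orthogonal approximation, first bound).**
For `ψ ∈ C²` odd with bounded first and second derivatives and `g₂ ∈ C¹` with `g₂, g₂′`
of at most polynomial growth, and `(z₁, z₂)` a centered Gaussian pair with covariances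
`C_{ij}` (`C₂₂ > 0`), one has
`|E ψ(z₁)g₂(z₂) − C₁₂ E ψ′(z₁) E g₂′(z₂)| ≤ L₁ Δ₁₂²` with `Δ₁₂ = C₁₂/C₂₂` and `L₁`
depending only on `ψ, g₂` and the variances `C₁₁, C₂₂`. -/
theorem orthogonal_approximation_first
    (ψ g₂ : ℝ → ℝ)
    (hψC2 : ContDiff ℝ 2 ψ) (hψodd : ∀ x, ψ (-x) = -ψ x)
    (hψbd : ∃ K, ∀ x, |deriv ψ x| ≤ K ∧ |deriv (deriv ψ) x| ≤ K)
    (hg₂C1 : ContDiff ℝ 1 g₂)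
    (hg₂poly : ∃ c : ℝ, ∃ q : ℕ, ∀ x, |g₂ x| ≤ c * (1 + |x| ^ q) ∧
      |deriv g₂ x| ≤ c * (1 + |x| ^ q))
    (C11 C22 : ℝ) (hC22 : 0 < C22) :
    ∃ L₁ > 0, ∀ C12 : ℝ, C12 ^ 2 ≤ C11 * C22 →
      |(∫ g, ψ (gaussZ1 C11 C12 C22 g) * g₂ (gaussZ2 C22 g) ∂(stdG.prod stdG)) -
        C12 * (∫ g, deriv ψ (gaussZ1 C11 C12 C22 g) ∂(stdG.prod stdG)) *
          (∫ g, deriv g₂ (gaussZ2 C22 g) ∂(stdG.prod stdG))| ≤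
      L₁ * (C12 / C22) ^ 2 := by
  obtain ⟨K, hK⟩ := hψbd
  obtain ⟨c, q, hc⟩ := hg₂poly
  have hK0 : 0 ≤ K := (abs_nonneg _).trans (hK 0).1
  set s := Real.sqrt C22
  have hs : 0 < s := Real.sqrt_pos.2 hC22
  have hs2 : s ^ 2 = C22 := Real.sq_sqrt hC22.le
  set L := K * (∫ y, y ^ 2 * |g₂ (s * y)| ∂stdG) +
    |s| * (K * (∫ y, |y| ∂stdG)) * |∫ y, deriv g₂ (s * y) ∂stdG|
  have hL : 0 ≤ L := by positivity
  refine ⟨L * C22 + 1, by positivity, fun C12 _ ↦ ?_⟩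
  have h := abs_integral_mul_sub_le hψC2 hψodd (fun x ↦ (hK x).1) (fun x ↦ (hK x).2) hg₂C1
    (fun x ↦ (hc x).1) (fun x ↦ (hc x).2) (C12 / s) (Real.sqrt (C11 - C12 ^ 2 / C22)) s
  rw [div_mul_cancel₀ _ hs.ne'] at h
  have e : ∫ g, deriv g₂ (gaussZ2 C22 g) ∂(stdG.prod stdG) = ∫ y, deriv g₂ (s * y) ∂stdG := by
    simp only [gaussZ2]
    rw [integral_fun_snd (fun y ↦ deriv g₂ (s * y))]
    simp
  rw [e]
  refine h.trans ?_
  calc L * (C12 / s) ^ 2 = L * C22 * (C12 / C22) ^ 2 := by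
        rw [div_pow, hs2]; field_simp
    _ ≤ (L * C22 + 1) * (C12 / C22) ^ 2 := by gcongr; linarith

end
end

section
/- Post-activations moments (Lemma C.1). Define σ_0 = 1, σ_ℓ = E φ²(Z√σ_{ℓ−1}) and ρ_ℓ = E φ′(Z√σ_{ℓ−1}) for Z ~ N(0,1) and ℓ = 1,…,L. Let g be any one of the functions x ↦ φ²(x), x ↦ φ′(x), or x ↦ xφ(x). Then for every positive integer k and every ℓ ∈ {1,…,L} there exists a constant C_{k,φ} > 0 (depending only on k and φ) such that E| (1/d_ℓ) ∑_{i=1}^{d_ℓ} g( W_i^{*(ℓ)}·X_μ^{(ℓ−1)} / √d_{ℓ−1} ) − E g(Z√σ_{ℓ−1}) |^k ≤ C_{k,φ} / d_{[0:ℓ]}^{k/2}, where d_{[0:ℓ]} = min{d_0,…,d_ℓ} and W_i^{*(ℓ)} is the i-th row of W^{*(ℓ)}. -/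
open MeasureTheory ProbabilityTheory

noncomputable section

instance : IsProbabilityMeasure stdG := by unfold stdG; infer_instance

/-- Standard Gaussian measure on `Fin k → ℝ`. -/
def stdGPi (k : ℕ) : Measure (Fin k → ℝ) := Measure.pi fun _ => stdG

instance (k : ℕ) : IsProbabilityMeasure (stdGPi k) := by unfold stdGPi; infer_instance

/-- The space of weights of an `L`-hidden-layer network with widths `d 0, …, d L`. -/
abbrev Wspace (d : ℕ → ℕ) (L : ℕ) :=
  (ℓ : Fin L) → Fin (d ((ℓ : ℕ) + 1)) → Fin (d (ℓ : ℕ)) → ℝ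

/-- i.i.d. standard Gaussian measure on the weights. -/
def Wmeasure (d : ℕ → ℕ) (L : ℕ) : Measure (Wspace d L) :=
  Measure.pi fun ℓ => Measure.pi fun _ => stdGPi (d (ℓ : ℕ))

instance (d : ℕ → ℕ) (L : ℕ) : IsProbabilityMeasure (Wmeasure d L) := by
  unfold Wmeasure; infer_instance

/-- Extension of a finite collection of weight matrices to all layer indices (by zero). -/
def extW {d : ℕ → ℕ} {L : ℕ} (W : Wspace d L) (ℓ : ℕ) : Fin (d (ℓ + 1)) → Fin (d ℓ) → ℝ :=
  if h : ℓ < L then W ⟨ℓ, h⟩ else 0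

/-- Post-activations `X^{(ℓ)} = φ(W^{(ℓ)} X^{(ℓ-1)} / √d_{ℓ-1})`. -/
def feat (φ : ℝ → ℝ) (d : ℕ → ℕ) (W : (ℓ : ℕ) → Fin (d (ℓ + 1)) → Fin (d ℓ) → ℝ)
    (x0 : Fin (d 0) → ℝ) : (ℓ : ℕ) → Fin (d ℓ) → ℝ
  | 0 => x0
  | (ℓ + 1) => fun i => φ ((∑ j, W ℓ i j * feat φ d W x0 ℓ j) / Real.sqrt (d ℓ : ℝ))

/-- Output kernel `P_out(y | x)`. -/
def Pout {p : ℕ} (PA : Measure (Fin p → ℝ)) (Δ : ℝ) (f : ℝ → (Fin p → ℝ) → ℝ)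
    (y x : ℝ) : ℝ :=
  ∫ A, Real.exp (-(y - f x A) ^ 2 / (2 * Δ)) / Real.sqrt (2 * Real.pi * Δ) ∂PA

/-- The channel smeared with the extra Gaussian noise `√ε ξ`. -/
def PoutEps {p : ℕ} (PA : Measure (Fin p → ℝ)) (Δ : ℝ) (f : ℝ → (Fin p → ℝ) → ℝ)
    (ε y s : ℝ) : ℝ :=
  ∫ ξ, Pout PA Δ f y (s + Real.sqrt ε * ξ) ∂stdG

/-- The coefficients `σ_ℓ`. -/
def sigmaC (φ : ℝ → ℝ) : ℕ → ℝ
  | 0 => 1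
  | (ℓ + 1) => ∫ z, (φ (z * Real.sqrt (sigmaC φ ℓ))) ^ 2 ∂stdG

/-- The coefficients `ρ_ℓ` (meaningful for `ℓ ≥ 1`). -/
def rhoC (φ : ℝ → ℝ) (ℓ : ℕ) : ℝ :=
  ∫ z, deriv φ (z * Real.sqrt (sigmaC φ (ℓ - 1))) ∂stdG

/-- The coefficients `ε_ℓ = σ_ℓ - σ_{ℓ-1} ρ_ℓ²` (meaningful for `ℓ ≥ 1`). -/
def epsC (φ : ℝ → ℝ) (ℓ : ℕ) : ℝ :=
  sigmaC φ ℓ - sigmaC φ (ℓ - 1) * (rhoC φ ℓ) ^ 2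

/-- `d_m = min{d_0, …, d_L}`. -/
def dmin (d : ℕ → ℕ) (L : ℕ) : ℕ :=
  (Finset.range (L + 1)).inf' (Finset.nonempty_range_iff.mpr (Nat.succ_ne_zero L)) d

/-- Linear readout of the `L`-layer network: `a⊤ X^{(L)} / √d_L`. -/
def netOut (φ : ℝ → ℝ) (d : ℕ → ℕ) (L : ℕ) (W : Wspace d L) (a : Fin (d L) → ℝ)
    (x0 : Fin (d 0) → ℝ) : ℝ :=
  (∑ i, a i * feat φ d (extW W) x0 L i) / Real.sqrt (d L : ℝ)

/-- Partition function (normalisation of the Bayes posterior) of the `L`-layer model. -/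
def partFun (L p : ℕ) (PA : Measure (Fin p → ℝ)) [IsProbabilityMeasure PA]
    (Δ ρ ε : ℝ) (φ : ℝ → ℝ) (f : ℝ → (Fin p → ℝ) → ℝ) (d : ℕ → ℕ) (n : ℕ)
    (X : Fin n → Fin (d 0) → ℝ) (Y : Fin n → ℝ) : ℝ :=
  ∫ θ : Wspace d L × (Fin (d L) → ℝ),
      ∏ μ, PoutEps PA Δ f ε (Y μ) (ρ * netOut φ d L θ.1 θ.2 (X μ))
    ∂((Wmeasure d L).prod (stdGPi (d L)))

/-- Space of all the quenched randomness of the `L`-layer teacher model: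
inputs, teacher weights, readout, output noises `ξ*`, label noises `Z` and channel
randomness `A`. -/
abbrev Dspace (d : ℕ → ℕ) (L p n : ℕ) :=
  (Fin n → Fin (d 0) → ℝ) × Wspace d L × (Fin (d L) → ℝ) ×
    (Fin n → ℝ) × (Fin n → ℝ) × (Fin n → Fin p → ℝ)

/-- Law of the quenched randomness. -/
def Dmeasure (d : ℕ → ℕ) (L p n : ℕ) (PA : Measure (Fin p → ℝ))
    [IsProbabilityMeasure PA] : Measure (Dspace d L p n) :=
  (Measure.pi fun _ : Fin n => stdGPi (d 0)).prod
    ((Wmeasure d L).prod ((stdGPi (d L)).prod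
      ((stdGPi n).prod ((stdGPi n).prod (Measure.pi fun _ : Fin n => PA)))))

/-- Teacher pre-readout signal `S_μ = ρ a*⊤X_μ^{(L)}/√d_L + √ε ξ*_μ`. -/
def Ssig (φ : ℝ → ℝ) (d : ℕ → ℕ) (L p n : ℕ) (ρ ε : ℝ) (ω : Dspace d L p n)
    (μi : Fin n) : ℝ :=
  ρ * netOut φ d L ω.2.1 ω.2.2.1 (ω.1 μi) + Real.sqrt ε * ω.2.2.2.1 μi

/-- Teacher responses `Y_μ = f(S_μ; A_μ) + √Δ Z_μ`. -/
def Yresp (φ : ℝ → ℝ) (f : ℝ → (Fin p → ℝ) → ℝ) (d : ℕ → ℕ) (L n : ℕ)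
    (ρ ε Δ : ℝ) (ω : Dspace d L p n) (μi : Fin n) : ℝ :=
  f (Ssig φ d L p n ρ ε ω μi) (ω.2.2.2.2.2 μi) + Real.sqrt Δ * ω.2.2.2.2.1 μi

/-- Mutual information per sample
`(1/n) I_n = E log P_out(Y_1|S_1) - (1/n) E log Z_L(D_L)`
(the first term is written as an average over samples, all equal by symmetry). -/
def MIper (L p : ℕ) (PA : Measure (Fin p → ℝ)) [IsProbabilityMeasure PA]
    (Δ ρ ε : ℝ) (φ : ℝ → ℝ) (f : ℝ → (Fin p → ℝ) → ℝ) (d : ℕ → ℕ) (n : ℕ) : ℝ :=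
  (1 / (n : ℝ)) * ∑ μi : Fin n,
      ∫ ω, Real.log (Pout PA Δ f (Yresp φ f d L n ρ ε Δ ω μi) (Ssig φ d L p n ρ ε ω μi))
        ∂(Dmeasure d L p n PA)
    - (1 / (n : ℝ)) *
      ∫ ω, Real.log (partFun L p PA Δ ρ ε φ f d n ω.1 (Yresp φ f d L n ρ ε Δ ω))
        ∂(Dmeasure d L p n PA)




/-- Integrating over a product space is unchanged by resampling one coordinate. -/
lemma lintegral_pi_resample {ι : Type*} [Fintype ι] [DecidableEq ι] {X : ι → Type*}
    [∀ i, MeasurableSpace (X i)] (μ : ∀ i, Measure (X i)) [∀ i, IsProbabilityMeasure (μ i)]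
    (i : ι) {f : (∀ i, X i) → ENNReal} (hf : Measurable f) :
    ∫⁻ x, f x ∂Measure.pi μ
      = ∫⁻ x, ∫⁻ y, f (Function.update x i y) ∂μ i ∂Measure.pi μ := by
  have hs := lmarginal_singleton (μ := μ) f i
  have hm : Measurable (∫⋯∫⁻_{i}, f ∂μ) := hf.lmarginal μ
  rw [← hs]
  refine lintegral_eq_of_lmarginal_eq (μ := μ) {i} hf hm ?_
  funext x
  rw [lmarginal_singleton (μ := μ) (∫⋯∫⁻_{i}, f ∂μ) i]
  simp [lmarginal_update_of_mem]

lemma exp_le_one_add_add_sq_mul_exp_abs (u : ℝ) :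
    Real.exp u ≤ 1 + u + u ^ 2 * Real.exp |u| := by
  have h := Complex.norm_exp_sub_sum_le_norm_mul_exp (u : ℂ) 2
  simp only [Finset.sum_range_succ, Finset.range_zero, Finset.sum_empty] at h
  norm_num at h
  have h2 : Complex.exp u - (1 + u) = ((Real.exp u - (1 + u) : ℝ) : ℂ) := by push_cast; rfl
  rw [h2, Complex.norm_real, Real.norm_eq_abs] at h
  linarith [le_abs_self (Real.exp u - (1 + u))]

lemma sq_mul_exp_le {lam y : ℝ} (hlam : 0 < lam) :
    y ^ 2 * Real.exp (lam * |y|) ≤ 2 / lam ^ 2 * Real.exp (2 * lam * |y|) := by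
  have h := Real.pow_div_factorial_le_exp (x := lam * |y|) (by positivity) 2
  have h2 : Real.exp (2 * lam * |y|) = Real.exp (lam * |y|) * Real.exp (lam * |y|) := by
    rw [← Real.exp_add]; ring_nf
  rw [h2, ← mul_assoc]
  gcongr
  rw [div_mul_eq_mul_div, le_div_iff₀ (by positivity)]
  norm_num [mul_pow] at h
  linarith

/-- A centred variable with an exponential moment has a sub-Gaussian moment generating function
near the origin. -/
lemma integral_exp_mul_le {α : Type*} [MeasurableSpace α] (μ : Measure α)
    [IsProbabilityMeasure μ] {Y : α → ℝ} (hY : Measurable Y) (hYi : Integrable Y μ)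
    (hY0 : ∫ x, Y x ∂μ = 0) {lam : ℝ} (hlam : 0 < lam)
    (hexp : Integrable (fun x => Real.exp (2 * lam * |Y x|)) μ) {t : ℝ} (ht : |t| ≤ lam) :
    Integrable (fun x => Real.exp (t * Y x)) μ ∧
      ∫ x, Real.exp (t * Y x) ∂μ
        ≤ Real.exp (t ^ 2 * (2 / lam ^ 2 * ∫ x, Real.exp (2 * lam * |Y x|) ∂μ)) := by
  have hint : Integrable (fun x => Real.exp (t * Y x)) μ := by
    refine hexp.mono' (by fun_prop) (.of_forall fun x => ?_)
    rw [Real.norm_eq_abs, Real.abs_exp]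
    refine Real.exp_le_exp.2 ?_
    calc t * Y x ≤ |t * Y x| := le_abs_self _
      _ = |t| * |Y x| := abs_mul _ _
      _ ≤ lam * |Y x| := by gcongr
      _ ≤ 2 * lam * |Y x| := by nlinarith [abs_nonneg (Y x)]
  refine ⟨hint, ?_⟩
  have hb : ∀ x, Real.exp (t * Y x)
      ≤ 1 + t * Y x + t ^ 2 * (2 / lam ^ 2 * Real.exp (2 * lam * |Y x|)) := fun x => by
    refine (exp_le_one_add_add_sq_mul_exp_abs _).trans ?_
    have h1 : Real.exp |t * Y x| ≤ Real.exp (lam * |Y x|) := by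
      rw [abs_mul]; gcongr
    have h2 := sq_mul_exp_le (y := Y x) hlam
    calc _ ≤ 1 + t * Y x + (t * Y x) ^ 2 * Real.exp (lam * |Y x|) := by gcongr
      _ = 1 + t * Y x + t ^ 2 * (Y x ^ 2 * Real.exp (lam * |Y x|)) := by ring
      _ ≤ _ := by gcongr
  have hi1 : Integrable (fun x => 1 + t * Y x) μ := (integrable_const 1).add (hYi.const_mul t)
  have hi2 := (hexp.const_mul (2 / lam ^ 2)).const_mul (t ^ 2)
  calc ∫ x, Real.exp (t * Y x) ∂μ
      ≤ ∫ x, (1 + t * Y x + t ^ 2 * (2 / lam ^ 2 * Real.exp (2 * lam * |Y x|))) ∂μ :=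
        integral_mono hint (hi1.add hi2) hb
    _ = t ^ 2 * (2 / lam ^ 2 * ∫ x, Real.exp (2 * lam * |Y x|) ∂μ) + 1 := by
        rw [integral_add hi1 hi2, integral_add (integrable_const 1) (hYi.const_mul t),
          integral_const_mul, integral_const_mul, integral_const_mul, hY0]
        simp [add_comm]
    _ ≤ _ := Real.add_one_le_exp _

lemma abs_pow_le_exp_add_exp {a : ℝ} (ha : 0 < a) (y : ℝ) (k : ℕ) :
    |y| ^ k ≤ k.factorial / a ^ k * (Real.exp (a * y) + Real.exp (-a * y)) := by
  have h := Real.pow_div_factorial_le_exp (x := a * |y|) (by positivity) k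
  rw [div_le_iff₀ (by positivity), mul_pow] at h
  have h2 : Real.exp (a * |y|) ≤ Real.exp (a * y) + Real.exp (-a * y) := by
    rcases abs_cases y with ⟨hy, -⟩ | ⟨hy, -⟩ <;> rw [hy]
    · linarith [Real.exp_pos (-a * y)]
    · rw [mul_neg, ← neg_mul]; linarith [Real.exp_pos (a * y)]
  rw [div_mul_eq_mul_div, le_div_iff₀ (by positivity)]
  calc |y| ^ k * a ^ k ≤ Real.exp (a * |y|) * k.factorial := by linarith
    _ ≤ (Real.exp (a * y) + Real.exp (-a * y)) * k.factorial := by gcongr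
    _ = _ := by ring

/-- Moments of the empirical mean of i.i.d. centred variables with an exponential moment. -/
lemma exists_moment_mean_le {α : Type*} [MeasurableSpace α] (μ : Measure α)
    [IsProbabilityMeasure μ] {Y : α → ℝ} (hY : Measurable Y) (hYi : Integrable Y μ)
    (hY0 : ∫ x, Y x ∂μ = 0) {lam : ℝ} (hlam : 0 < lam)
    (hexp : Integrable (fun x => Real.exp (2 * lam * |Y x|)) μ) (k : ℕ) :
    ∃ C > 0, ∀ n : ℕ, 1 ≤ n →
      ∫⁻ z, ENNReal.ofReal (|1 / (n : ℝ) * ∑ i : Fin n, Y (z i)| ^ k)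
        ∂Measure.pi (fun _ : Fin n => μ) ≤ ENNReal.ofReal (C / √(n : ℝ) ^ k) := by
  set c := 2 / lam ^ 2 * ∫ x, Real.exp (2 * lam * |Y x|) ∂μ
  refine ⟨k.factorial / lam ^ k * (2 * Real.exp (lam ^ 2 * c)), by positivity, fun n hn => ?_⟩
  have hn0 : (0 : ℝ) < n := by exact_mod_cast hn
  have hs0 : 0 < √(n : ℝ) := Real.sqrt_pos.2 hn0
  have hs1 : 1 ≤ √(n : ℝ) := Real.one_le_sqrt.2 (by exact_mod_cast hn)
  have hss : √(n : ℝ) ^ 2 = n := Real.sq_sqrt hn0.le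
  have key : ∀ t : ℝ, |t| = lam →
      Integrable (fun z : Fin n → α => Real.exp (t * √(n : ℝ) * (1 / (n : ℝ) * ∑ i, Y (z i))))
        (Measure.pi (fun _ : Fin n => μ)) ∧
      ∫ z, Real.exp (t * √(n : ℝ) * (1 / (n : ℝ) * ∑ i : Fin n, Y (z i)))
        ∂Measure.pi (fun _ : Fin n => μ) ≤ Real.exp (lam ^ 2 * c) := by
    intro t ht
    have habs : |t / √(n : ℝ)| ≤ lam := by
      rw [abs_div, ht, abs_of_pos hs0]; exact div_le_self hlam.le hs1
    obtain ⟨h1, h2⟩ := integral_exp_mul_le μ hY hYi hY0 hlam hexp habs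
    have heq : (fun z : Fin n → α =>
        Real.exp (t * √(n : ℝ) * (1 / (n : ℝ) * ∑ i, Y (z i))))
        = fun z => ∏ i, Real.exp (t / √(n : ℝ) * Y (z i)) := by
      funext z
      rw [← Real.exp_sum, ← Finset.mul_sum]
      congr 1
      nth_rewrite 2 [← hss]
      field_simp
    rw [heq]
    refine ⟨Integrable.fintype_prod (f := fun _ : Fin n => fun x => Real.exp (t / √(n : ℝ) * Y x))
      fun _ => h1, ?_⟩
    rw [integral_fintype_prod_eq_pow (fun x => Real.exp (t / √(n : ℝ) * Y x)), Fintype.card_fin]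
    calc _ ≤ Real.exp ((t / √(n : ℝ)) ^ 2 * c) ^ n :=
          pow_le_pow_left₀ (integral_nonneg fun _ => (Real.exp_pos _).le) h2 n
      _ = Real.exp (lam ^ 2 * c) := by
          rw [← Real.exp_nat_mul, div_pow, hss, ← sq_abs t, ht]
          congr 1; field_simp
  obtain ⟨hi1, hb1⟩ := key lam (abs_of_pos hlam)
  obtain ⟨hi2, hb2⟩ := key (-lam) (by rw [abs_neg, abs_of_pos hlam])
  have hi := (hi1.add hi2).const_mul (k.factorial / (lam * √(n : ℝ)) ^ k)
  calc _ ≤ ∫⁻ z, ENNReal.ofReal (k.factorial / (lam * √(n : ℝ)) ^ k *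
        (Real.exp (lam * √(n : ℝ) * (1 / (n : ℝ) * ∑ i : Fin n, Y (z i)))
        + Real.exp (-lam * √(n : ℝ) * (1 / (n : ℝ) * ∑ i : Fin n, Y (z i)))))
        ∂Measure.pi (fun _ : Fin n => μ) := by
        refine lintegral_mono fun z => ENNReal.ofReal_le_ofReal ?_
        refine (abs_pow_le_exp_add_exp (a := lam * √(n : ℝ)) (by positivity) _ k).trans_eq ?_
        rw [neg_mul lam]
    _ = ENNReal.ofReal (∫ z, k.factorial / (lam * √(n : ℝ)) ^ k *
        (Real.exp (lam * √(n : ℝ) * (1 / (n : ℝ) * ∑ i : Fin n, Y (z i)))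
        + Real.exp (-lam * √(n : ℝ) * (1 / (n : ℝ) * ∑ i : Fin n, Y (z i))))
        ∂Measure.pi (fun _ : Fin n => μ)) :=
        (ofReal_integral_eq_lintegral_ofReal hi (.of_forall fun z => by
          simp only [Pi.zero_apply, Pi.add_apply]; positivity)).symm
    _ ≤ _ := by
        refine ENNReal.ofReal_le_ofReal ?_
        rw [integral_const_mul, integral_add hi1 hi2, mul_pow]
        calc _ ≤ k.factorial / (lam ^ k * √(n : ℝ) ^ k) *
              (Real.exp (lam ^ 2 * c) + Real.exp (lam ^ 2 * c)) := by gcongr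
          _ = _ := by field_simp; ring

/-- Moments of the empirical mean of nonnegative i.i.d. variables are bounded by the moment of a
single variable. -/
lemma lintegral_mean_pow_le {α : Type*} [MeasurableSpace α] (μ : Measure α)
    [IsProbabilityMeasure μ] {f : α → ℝ} (hf0 : ∀ x, 0 ≤ f x) (k : ℕ)
    (hfk : Integrable (fun x => f x ^ k) μ) {n : ℕ} (hn : 1 ≤ n) :
    ∫⁻ z, ENNReal.ofReal ((1 / (n : ℝ) * ∑ i : Fin n, f (z i)) ^ k)
      ∂Measure.pi (fun _ : Fin n => μ) ≤ ENNReal.ofReal (∫ x, f x ^ k ∂μ) := by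
  have hn0 : (0 : ℝ) < n := by exact_mod_cast hn
  have hi : ∀ i : Fin n, Integrable (fun z : Fin n → α => f (z i) ^ k)
      (Measure.pi (fun _ : Fin n => μ)) := fun i =>
    integrable_comp_eval (μ := fun _ : Fin n => μ) (i := i) hfk
  have hsum : Integrable (fun z : Fin n → α => ∑ i, 1 / (n : ℝ) * f (z i) ^ k)
      (Measure.pi (fun _ : Fin n => μ)) :=
    integrable_finsetSum _ fun i _ => (hi i).const_mul _
  calc _ ≤ ∫⁻ z, ENNReal.ofReal (∑ i : Fin n, 1 / (n : ℝ) * f (z i) ^ k)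
        ∂Measure.pi (fun _ : Fin n => μ) := by
        refine lintegral_mono fun z => ENNReal.ofReal_le_ofReal ?_
        rw [Finset.mul_sum]
        refine Real.pow_arith_mean_le_arith_mean_pow _ (fun _ => 1 / (n : ℝ)) (fun i => f (z i))
          (fun _ _ => by positivity) ?_ (fun i _ => hf0 _) k
        simp [hn0.ne']
    _ = ENNReal.ofReal (∫ z, ∑ i : Fin n, 1 / (n : ℝ) * f (z i) ^ k
        ∂Measure.pi (fun _ : Fin n => μ)) :=
        (ofReal_integral_eq_lintegral_ofReal hsum (.of_forall fun z =>
          Finset.sum_nonneg fun i _ => mul_nonneg (by positivity) (pow_nonneg (hf0 _) _))).symm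
    _ = _ := by
        congr 1
        rw [integral_finsetSum _ fun i _ => (hi i).const_mul _]
        have : ∀ i : Fin n, ∫ z : Fin n → α, 1 / (n : ℝ) * f (z i) ^ k
            ∂Measure.pi (fun _ : Fin n => μ) = 1 / (n : ℝ) * ∫ x, f x ^ k ∂μ := fun i => by
          rw [integral_const_mul]
          congr 1
          exact integral_comp_eval (μ := fun _ : Fin n => μ) (i := i) hfk.aestronglyMeasurable
        simp only [this, Finset.sum_const, Finset.card_univ, Fintype.card_fin, nsmul_eq_mul]
        field_simp

/-- A weighted sum of i.i.d. standard Gaussians is Gaussian. -/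
lemma stdGPi_map_dot (n : ℕ) (x : Fin n → ℝ) :
    (stdGPi n).map (fun w => (∑ j, w j * x j) / √(n : ℝ))
      = stdG.map (fun z => √((1 / (n : ℝ)) * ∑ j, x j ^ 2) * z) := by
  have hm : Measurable (fun w : Fin n → ℝ => (∑ j, w j * x j) / √(n : ℝ)) := by fun_prop
  have : IsProbabilityMeasure ((stdGPi n).map (fun w => (∑ j, w j * x j) / √(n : ℝ))) :=
    Measure.isProbabilityMeasure_map hm.aemeasurable
  have : IsProbabilityMeasure (stdG.map (fun z => √((1 / (n : ℝ)) * ∑ j, x j ^ 2) * z)) :=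
    Measure.isProbabilityMeasure_map (by fun_prop)
  have hs : 0 ≤ (1 / (n : ℝ)) * ∑ j, x j ^ 2 :=
    mul_nonneg (by positivity) (Finset.sum_nonneg fun _ _ => sq_nonneg _)
  have hg : ∀ t : ℝ, ∫ z, Complex.exp (t * z * Complex.I) ∂stdG
      = Complex.exp (-t ^ 2 / 2) := fun t => by
    have := charFun_gaussianReal (μ := 0) (v := 1) t
    rw [charFun_apply_real] at this
    rw [stdG, this]
    simp [neg_div]
  refine Measure.ext_of_charFun ?_
  funext t
  rw [charFun_apply_real, charFun_apply_real, integral_map hm.aemeasurable (by fun_prop),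
    integral_map (by fun_prop) (by fun_prop)]
  have h1 : ∀ w : Fin n → ℝ, Complex.exp (t * ((∑ j, w j * x j) / √(n : ℝ) : ℝ) * Complex.I)
      = ∏ j, Complex.exp ((t * x j / √(n : ℝ) : ℝ) * w j * Complex.I) := fun w => by
    rw [← Complex.exp_sum]
    congr 1
    push_cast
    rw [← Finset.sum_mul, Finset.sum_div, Finset.mul_sum]
    congr 1
    exact Finset.sum_congr rfl fun j _ => by ring
  have h2 : ∀ z : ℝ, Complex.exp (t * (√((1 / (n : ℝ)) * ∑ j, x j ^ 2) * z : ℝ) * Complex.I)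
      = Complex.exp ((t * √((1 / (n : ℝ)) * ∑ j, x j ^ 2) : ℝ) * z * Complex.I) := fun z => by
    congr 1; push_cast; ring
  simp_rw [h1, h2, hg]
  rw [stdGPi, integral_fintype_prod_eq_prod
    (fun j (z : ℝ) => Complex.exp ((t * x j / √(n : ℝ) : ℝ) * z * Complex.I))]
  simp_rw [hg]
  rw [← Complex.exp_sum]
  congr 1
  norm_cast
  rw [mul_pow, Real.sq_sqrt hs, Finset.mul_sum, Finset.mul_sum, ← Finset.sum_div,
    Finset.sum_neg_distrib]
  congr 2
  refine Finset.sum_congr rfl fun j _ => ?_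
  rw [div_pow, Real.sq_sqrt (Nat.cast_nonneg n)]
  ring

lemma integrable_exp_sq_stdG : Integrable (fun z : ℝ => Real.exp (z ^ 2 / 4)) stdG := by
  rw [stdG, gaussianReal_of_var_ne_zero _ one_ne_zero,
    integrable_withDensity_iff_integrable_smul' (measurable_gaussianPDF 0 1)
      (.of_forall fun _ => gaussianPDF_lt_top)]
  have h := (integrable_exp_neg_mul_sq (b := 1 / 4) (by norm_num)).const_mul (√(2 * Real.pi))⁻¹
  refine h.congr (.of_forall fun z => ?_)
  simp only [toReal_gaussianPDF, gaussianPDFReal, smul_eq_mul, NNReal.coe_one, mul_one, sub_zero]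
  rw [mul_assoc, ← Real.exp_add]
  congr 2
  ring

lemma integrable_one_add_sq_pow_stdG (k : ℕ) :
    Integrable (fun z : ℝ => (1 + z ^ 2) ^ k) stdG := by
  refine ((integrable_exp_sq_stdG.const_mul (Real.exp (1 / 4))).const_mul
    (k.factorial * 4 ^ k)).mono' (by fun_prop) (.of_forall fun z => ?_)
  have h := Real.pow_div_factorial_le_exp (x := (1 + z ^ 2) / 4) (by positivity) k
  rw [Real.norm_of_nonneg (by positivity), ← Real.exp_add, ← add_div]
  rw [div_pow, div_div, div_le_iff₀ (by positivity)] at h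
  linarith

/-- The class of functions with linearly growing local Lipschitz constants. -/
def LocLip (A : ℝ) (g : ℝ → ℝ) : Prop :=
  ∀ a b, |g a - g b| ≤ A * |a - b| * (1 + |a| + |b|)

lemma LocLip.continuous {A : ℝ} {g : ℝ → ℝ} (h : LocLip A g) : Continuous g := by
  refine continuous_iff_continuousAt.2 fun b => ?_
  refine tendsto_iff_dist_tendsto_zero.2 ?_
  refine squeeze_zero (fun _ => dist_nonneg) (fun a => h a b) ?_
  have : Continuous fun a : ℝ => A * |a - b| * (1 + |a| + |b|) := by fun_prop
  simpa using this.tendsto b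

lemma LocLip.abs_le {A : ℝ} (hA : 0 ≤ A) {g : ℝ → ℝ} (h : LocLip A g) (r z : ℝ) :
    |g (r * z)| ≤ (|g 0| + A * (|r| + |r| ^ 2)) * (1 + z ^ 2) := by
  have h1 := h (r * z) 0
  simp only [sub_zero, abs_zero, add_zero, abs_mul] at h1
  have h2 : |g (r * z)| ≤ |g 0| + |g (r * z) - g 0| := by
    linarith [abs_sub_abs_le_abs_sub (g (r * z)) (g 0)]
  have h3 : |z| ≤ 1 + z ^ 2 := by rw [← sq_abs]; nlinarith [sq_nonneg (|z| - 1)]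
  have h4 : A * (|r| * |z|) * (1 + |r| * |z|)
      = A * (|r| * |z| + |r| ^ 2 * z ^ 2) := by rw [← sq_abs z]; ring
  have h5 : A * (|r| * |z| + |r| ^ 2 * z ^ 2)
      ≤ A * (|r| * (1 + z ^ 2) + |r| ^ 2 * (1 + z ^ 2)) := by
    gcongr; linarith
  nlinarith [mul_nonneg (abs_nonneg (g 0)) (sq_nonneg z)]

lemma abs_sqrt_sub_sqrt_le {s σ : ℝ} (hs : 0 ≤ s) (hσ : 0 < σ) :
    |√s - √σ| ≤ |s - σ| / √σ := by
  have h0 : 0 < √σ := Real.sqrt_pos.2 hσ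
  have : s - σ = (√s - √σ) * (√s + √σ) := by
    nlinarith [Real.sq_sqrt hs, Real.sq_sqrt hσ.le]
  rw [le_div_iff₀ h0, this, abs_mul, abs_of_nonneg (by positivity : 0 ≤ √s + √σ)]
  gcongr
  linarith [Real.sqrt_nonneg s]

lemma LocLip.abs_sub_le {A : ℝ} (hA : 0 ≤ A) {g : ℝ → ℝ} (h : LocLip A g) {s σ : ℝ}
    (hs : 0 ≤ s) (hσ : 0 < σ) (z : ℝ) :
    |g (√s * z) - g (√σ * z)| ≤ A * (1 / √σ + 1) * |s - σ| * (1 + z ^ 2) := by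
  have h1 := abs_sqrt_sub_sqrt_le hs hσ
  have h0 : 0 < √σ := Real.sqrt_pos.2 hσ
  have h2 : |√s - √σ| * (√s + √σ) = |s - σ| := by
    rw [← abs_of_nonneg (by positivity : 0 ≤ √s + √σ), ← abs_mul]
    congr 1
    nlinarith [Real.sq_sqrt hs, Real.sq_sqrt hσ.le]
  have h3 : |z| ≤ 1 + z ^ 2 := by rw [← sq_abs]; nlinarith [sq_nonneg (|z| - 1)]
  calc _ ≤ A * |√s * z - √σ * z| * (1 + |√s * z| + |√σ * z|) := h _ _
    _ = A * (|√s - √σ| * |z| + |√s - √σ| * (√s + √σ) * z ^ 2) := by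
        rw [← sub_mul, abs_mul, abs_mul, abs_mul, abs_of_nonneg (Real.sqrt_nonneg s),
          abs_of_nonneg h0.le, ← sq_abs z]; ring
    _ ≤ A * (|s - σ| / √σ * (1 + z ^ 2) + |s - σ| * (1 + z ^ 2)) := by
        rw [h2]; gcongr; linarith
    _ = _ := by ring

/-- Empirical means of `g` over Gaussians of variance `s` concentrate around the mean of `g` at
variance `σ`, up to the discrepancy `|s - σ|`. -/
lemma LocLip.exists_moment_mean_le {A : ℝ} (hA : 0 ≤ A) {g : ℝ → ℝ} (h : LocLip A g) {σ : ℝ}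
    (hσ : 0 < σ) (k : ℕ) :
    ∃ C > 0, ∀ n : ℕ, 1 ≤ n → ∀ s : ℝ, 0 ≤ s →
      ∫⁻ z, ENNReal.ofReal (|1 / (n : ℝ) * ∑ i : Fin n, g (√s * z i)
        - ∫ z, g (z * √σ) ∂stdG| ^ k) ∂stdGPi n
      ≤ ENNReal.ofReal (C * (|s - σ| ^ k + 1 / √(n : ℝ) ^ k)) := by
  set G := ∫ z, g (z * √σ) ∂stdG with hG
  set B := |g 0| + A * (|√σ| + |√σ| ^ 2)
  have hB0 : 0 ≤ B := by positivity
  have hgc : Continuous g := h.continuous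
  have hgi : Integrable (fun z => g (√σ * z)) stdG := by
    refine ((integrable_one_add_sq_pow_stdG 1).const_mul B).mono' (by fun_prop)
      (.of_forall fun z => ?_)
    rw [pow_one]
    exact h.abs_le hA (√σ) z
  have hY0 : ∫ z, (g (√σ * z) - G) ∂stdG = 0 := by
    rw [integral_sub hgi (integrable_const _), hG]
    simp [mul_comm]
  set D := B + |G| + 1
  have hD0 : 0 < D := by positivity
  have hYb : ∀ z, |g (√σ * z) - G| ≤ D * (1 + z ^ 2) := fun z => by
    have h1 := abs_sub (g (√σ * z)) G
    have h2 := h.abs_le hA (√σ) z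
    nlinarith [mul_nonneg (abs_nonneg G) (sq_nonneg z), sq_nonneg z]
  have hexp : Integrable (fun z => Real.exp (2 * (1 / (8 * D)) * |g (√σ * z) - G|)) stdG := by
    refine (integrable_exp_sq_stdG.const_mul (Real.exp (1 / 4))).mono' (by fun_prop)
      (.of_forall fun z => ?_)
    rw [Real.norm_eq_abs, Real.abs_exp, ← Real.exp_add, Real.exp_le_exp, ← add_div]
    calc _ ≤ 2 * (1 / (8 * D)) * (D * (1 + z ^ 2)) := by gcongr; exact hYb z
      _ = _ := by field_simp; ring
  obtain ⟨C₁, hC₁, hm⟩ := _root_.exists_moment_mean_le stdG (by fun_prop)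
    (hgi.sub (integrable_const G)) hY0 (by positivity : 0 < 1 / (8 * D)) hexp k
  set E := A * (1 / √σ + 1)
  have hE0 : 0 ≤ E := by positivity
  set M := ∫ z : ℝ, (1 + z ^ 2) ^ k ∂stdG
  have hM0 : 0 ≤ M := integral_nonneg fun z => by positivity
  refine ⟨2 ^ (k - 1) * (E ^ k * M + C₁), by positivity, fun n hn s hs => ?_⟩
  have hn0 : (0 : ℝ) < n := by exact_mod_cast hn
  have hpt : ∀ z : Fin n → ℝ, |1 / (n : ℝ) * ∑ i : Fin n, g (√s * z i) - G| ^ k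
      ≤ 2 ^ (k - 1) * ((E * |s - σ|) ^ k * (1 / (n : ℝ) * ∑ i, (1 + z i ^ 2)) ^ k +
        |1 / (n : ℝ) * ∑ i, (g (√σ * z i) - G)| ^ k) := fun z => by
    have hsplit : 1 / (n : ℝ) * ∑ i : Fin n, g (√s * z i) - G
        = 1 / (n : ℝ) * ∑ i, (g (√s * z i) - g (√σ * z i))
          + 1 / (n : ℝ) * ∑ i, (g (√σ * z i) - G) := by
      simp only [Finset.sum_sub_distrib, Finset.sum_const, Finset.card_univ, Fintype.card_fin,
        nsmul_eq_mul]
      field_simp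
      ring
    have hfirst : |1 / (n : ℝ) * ∑ i, (g (√s * z i) - g (√σ * z i))|
        ≤ E * |s - σ| * (1 / (n : ℝ) * ∑ i, (1 + z i ^ 2)) := by
      rw [abs_mul, abs_of_pos (by positivity : 0 < 1 / (n : ℝ)), mul_left_comm]
      refine mul_le_mul_of_nonneg_left ?_ (by positivity)
      rw [Finset.mul_sum]
      exact (Finset.abs_sum_le_sum_abs _ _).trans
        (Finset.sum_le_sum fun i _ => h.abs_sub_le hA hs hσ (z i))
    rw [← mul_pow]
    refine le_trans ?_ (add_pow_le (by positivity) (abs_nonneg _) k)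
    rw [hsplit]
    refine pow_le_pow_left₀ (abs_nonneg _) ((abs_add_le _ _).trans ?_) k
    gcongr
  have hsq := lintegral_mean_pow_le stdG (f := fun z => 1 + z ^ 2) (fun z => by positivity) k
    (integrable_one_add_sq_pow_stdG k) hn
  calc _ ≤ ∫⁻ z, ENNReal.ofReal (2 ^ (k - 1)) * (ENNReal.ofReal ((E * |s - σ|) ^ k) *
        ENNReal.ofReal ((1 / (n : ℝ) * ∑ i, (1 + z i ^ 2)) ^ k) +
        ENNReal.ofReal (|1 / (n : ℝ) * ∑ i, (g (√σ * z i) - G)| ^ k)) ∂stdGPi n := by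
        refine lintegral_mono fun z => (ENNReal.ofReal_le_ofReal (hpt z)).trans_eq ?_
        rw [ENNReal.ofReal_mul (by positivity), ENNReal.ofReal_add (by positivity) (by positivity),
          ENNReal.ofReal_mul (by positivity)]
    _ = ENNReal.ofReal (2 ^ (k - 1)) * (ENNReal.ofReal ((E * |s - σ|) ^ k) *
        (∫⁻ z, ENNReal.ofReal ((1 / (n : ℝ) * ∑ i, (1 + z i ^ 2)) ^ k) ∂stdGPi n) +
        ∫⁻ z, ENNReal.ofReal (|1 / (n : ℝ) * ∑ i, (g (√σ * z i) - G)| ^ k) ∂stdGPi n) := by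
        rw [lintegral_const_mul _ (by fun_prop), lintegral_add_left (by fun_prop),
          lintegral_const_mul _ (by fun_prop)]
    _ ≤ ENNReal.ofReal (2 ^ (k - 1)) * (ENNReal.ofReal ((E * |s - σ|) ^ k) *
        ENNReal.ofReal M + ENNReal.ofReal (C₁ / √(n : ℝ) ^ k)) := by
        gcongr
        · exact hsq
        · exact hm n hn
    _ = ENNReal.ofReal (2 ^ (k - 1) * ((E * |s - σ|) ^ k * M + C₁ / √(n : ℝ) ^ k)) := by
        rw [← ENNReal.ofReal_mul (by positivity), ← ENNReal.ofReal_add (by positivity)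
          (by positivity), ← ENNReal.ofReal_mul (by positivity)]
    _ ≤ _ := by
        refine ENNReal.ofReal_le_ofReal ?_
        rw [mul_assoc (2 ^ (k - 1))]
        gcongr 2 ^ (k - 1) * ?_
        have e1 : 0 ≤ E ^ k * M * (1 / √(n : ℝ) ^ k) := by positivity
        have e2 : 0 ≤ C₁ * |s - σ| ^ k := by positivity
        rw [mul_pow, div_eq_mul_one_div C₁]
        nlinarith

/-- The empirical second moment of the post-activations of layer `m`. -/
def featSq (φ : ℝ → ℝ) (d : ℕ → ℕ) {L : ℕ} (m : ℕ) (ω : (Fin (d 0) → ℝ) × Wspace d L) : ℝ :=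
  (1 / (d m : ℝ)) * ∑ j, feat φ d (extW ω.2) ω.1 m j ^ 2

lemma featSq_nonneg (φ : ℝ → ℝ) (d : ℕ → ℕ) {L : ℕ} (m : ℕ)
    (ω : (Fin (d 0) → ℝ) × Wspace d L) : 0 ≤ featSq φ d m ω :=
  mul_nonneg (by positivity) (Finset.sum_nonneg fun _ _ => sq_nonneg _)

lemma measurable_extW {d : ℕ → ℕ} {L : ℕ} (m : ℕ) :
    Measurable fun W : Wspace d L => extW W m := by
  by_cases h : m < L
  · simp only [extW, h, dite_true]; exact measurable_pi_apply _
  · simp only [extW, h, dite_false]; exact measurable_const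

lemma measurable_extW_apply {d : ℕ → ℕ} {L : ℕ} (m : ℕ) (i : Fin (d (m + 1))) (j : Fin (d m)) :
    Measurable fun ω : (Fin (d 0) → ℝ) × Wspace d L => extW ω.2 m i j :=
  ((measurable_pi_apply j).comp ((measurable_pi_apply i).comp (measurable_extW m))).comp
    measurable_snd

lemma measurable_feat {φ : ℝ → ℝ} (hφ : Measurable φ) (d : ℕ → ℕ) {L : ℕ} (m : ℕ)
    (i : Fin (d m)) :
    Measurable fun ω : (Fin (d 0) → ℝ) × Wspace d L => feat φ d (extW ω.2) ω.1 m i := by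
  induction m with
  | zero => exact (measurable_pi_apply i).comp measurable_fst
  | succ m ih =>
    simp only [feat]
    refine hφ.comp (Measurable.div_const (Finset.measurable_fun_sum _ fun j _ => ?_) _)
    exact (measurable_extW_apply m i j).mul (ih j)

lemma feat_update (φ : ℝ → ℝ) (d : ℕ → ℕ) {L : ℕ} (W : Wspace d L) (x0 : Fin (d 0) → ℝ)
    (m : Fin L) (y : Fin (d ((m : ℕ) + 1)) → Fin (d (m : ℕ)) → ℝ) (r : ℕ) (hr : r ≤ m) :
    feat φ d (extW (Function.update W m y)) x0 r = feat φ d (extW W) x0 r := by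
  induction r with
  | zero => rfl
  | succ r ih =>
    have hne : (⟨r, by omega⟩ : Fin L) ≠ m := fun h => by
      have := congrArg Fin.val h
      simp only at this
      omega
    have hW : extW (Function.update W m y) r = extW W r := by
      simp only [extW, show r < L by omega, dite_true]
      exact Function.update_of_ne hne _ _
    simp only [feat, hW, ih (by omega)]

/-- Conditionally on the previous layer, the pre-activations are i.i.d. centred Gaussians. -/
lemma lintegral_preactivation (φ : ℝ → ℝ) (hφ : Measurable φ) (d : ℕ → ℕ) {L m : ℕ} (hm : m < L)
    {F : (Fin (d (m + 1)) → ℝ) → ENNReal} (hF : Measurable F) :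
    ∫⁻ ω : (Fin (d 0) → ℝ) × Wspace d L,
        F (fun i => (∑ j, extW ω.2 m i j * feat φ d (extW ω.2) ω.1 m j) / √(d m : ℝ))
      ∂((stdGPi (d 0)).prod (Wmeasure d L))
    = ∫⁻ ω : (Fin (d 0) → ℝ) × Wspace d L,
        ∫⁻ z, F (fun i => √(featSq φ d m ω) * z i) ∂stdGPi (d (m + 1))
      ∂((stdGPi (d 0)).prod (Wmeasure d L)) := by
  have hpre : Measurable fun ω : (Fin (d 0) → ℝ) × Wspace d L =>
      F (fun i => (∑ j, extW ω.2 m i j * feat φ d (extW ω.2) ω.1 m j) / √(d m : ℝ)) := by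
    refine hF.comp (measurable_pi_lambda _ fun i => Measurable.div_const
      (Finset.measurable_fun_sum _ fun j _ => ?_) _)
    exact (measurable_extW_apply m i j).mul (measurable_feat hφ d m j)
  have hsq : Measurable fun ω : (Fin (d 0) → ℝ) × Wspace d L => featSq φ d m ω :=
    (Finset.measurable_fun_sum _ fun j _ => (measurable_feat hφ d m j).pow_const 2).const_mul _
  have hpost : Measurable fun ω : (Fin (d 0) → ℝ) × Wspace d L =>
      ∫⁻ z, F (fun i => √(featSq φ d m ω) * z i) ∂stdGPi (d (m + 1)) := by
    refine Measurable.lintegral_prod_right' (f := fun p :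
      ((Fin (d 0) → ℝ) × Wspace d L) × (Fin (d (m + 1)) → ℝ) =>
        F (fun i => √(featSq φ d m p.1) * p.2 i)) ?_
    refine hF.comp (measurable_pi_lambda _ fun i => ?_)
    exact ((hsq.comp measurable_fst).sqrt).mul ((measurable_pi_apply i).comp measurable_snd)
  rw [lintegral_prod _ hpre.aemeasurable, lintegral_prod _ hpost.aemeasurable]
  refine lintegral_congr fun x0 => ?_
  refine (lintegral_pi_resample _ (⟨m, hm⟩ : Fin L)
    (hpre.comp measurable_prodMk_left)).trans (lintegral_congr fun W => ?_)
  set x := feat φ d (extW W) x0 m with hx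
  have h1 : ∀ y : Fin (d (m + 1)) → Fin (d m) → ℝ,
      extW (Function.update W ⟨m, hm⟩ y) m = y := fun y => by
    simp only [extW, hm, dite_true]
    exact Function.update_self ..
  simp only [Function.comp_apply, h1, feat_update φ d W x0 ⟨m, hm⟩ _ m le_rfl, ← hx]
  have hdot : Measurable fun w : Fin (d m) → ℝ => (∑ j, w j * x j) / √(d m : ℝ) := by fun_prop
  have hmap := Measure.pi_map_pi (μ := fun _ : Fin (d (m + 1)) => stdGPi (d m))
    (f := fun _ w => (∑ j, w j * x j) / √(d m : ℝ)) fun _ => hdot.aemeasurable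
  have hmap' := Measure.pi_map_pi (μ := fun _ : Fin (d (m + 1)) => stdG)
    (f := fun _ z => √((1 / (d m : ℝ)) * ∑ j, x j ^ 2) * z) fun _ => by fun_prop
  simp only [stdGPi_map_dot] at hmap
  rw [← hmap'] at hmap
  calc _ = ∫⁻ h, F h ∂(Measure.pi (fun _ : Fin (d (m + 1)) => stdGPi (d m))).map
        (fun y i => (∑ j, y i j * x j) / √(d m : ℝ)) := by
        rw [lintegral_map hF (by fun_prop)]
    _ = _ := by
        rw [hmap, lintegral_map hF (by fun_prop)]
        rfl

lemma one_le_dmin {d : ℕ → ℕ} {m : ℕ} (hd : ∀ j ≤ m, 1 ≤ d j) : 1 ≤ dmin d m :=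
  (Finset.le_inf'_iff _ _).2 fun j hj => hd j (by simpa [Nat.lt_succ_iff] using hj)

lemma dmin_le (d : ℕ → ℕ) {m j : ℕ} (hj : j ≤ m) : dmin d m ≤ d j :=
  Finset.inf'_le _ (by simpa [Nat.lt_succ_iff] using hj)

lemma dmin_succ_le (d : ℕ → ℕ) (m : ℕ) : dmin d (m + 1) ≤ dmin d m :=
  (Finset.le_inf'_iff _ _).2 fun _ hj =>
    dmin_le d (by simp only [Finset.mem_range] at hj; omega)

/-- Concentration of the empirical mean of `g` over the pre-activations of the next layer, given
concentration of the empirical second moment of layer `m`. -/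
lemma LocLip.exists_moment_layer_le {A : ℝ} (hA : 0 ≤ A) {g : ℝ → ℝ} (h : LocLip A g)
    {φ : ℝ → ℝ} (hφ : Measurable φ) {L m : ℕ} (hm : m < L) (hσ : 0 < sigmaC φ m) (k : ℕ)
    (hsq : ∃ C > 0, ∀ d : ℕ → ℕ, (∀ j ≤ L, 1 ≤ d j) →
      ∫⁻ ω : (Fin (d 0) → ℝ) × Wspace d L, ENNReal.ofReal (|featSq φ d m ω - sigmaC φ m| ^ k)
        ∂((stdGPi (d 0)).prod (Wmeasure d L)) ≤ ENNReal.ofReal (C / √(dmin d m : ℝ) ^ k)) :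
    ∃ C > 0, ∀ d : ℕ → ℕ, (∀ j ≤ L, 1 ≤ d j) →
      ∫⁻ ω : (Fin (d 0) → ℝ) × Wspace d L, ENNReal.ofReal
          (|(1 / (d (m + 1) : ℝ)) * ∑ i : Fin (d (m + 1)),
              g ((∑ j, extW ω.2 m i j * feat φ d (extW ω.2) ω.1 m j) / √(d m : ℝ)) -
            ∫ z, g (z * √(sigmaC φ m)) ∂stdG| ^ k)
        ∂((stdGPi (d 0)).prod (Wmeasure d L))
      ≤ ENNReal.ofReal (C / √(dmin d (m + 1) : ℝ) ^ k) := by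
  obtain ⟨C₁, hC₁, h₁⟩ := hsq
  obtain ⟨C₂, hC₂, h₂⟩ := h.exists_moment_mean_le hA hσ k
  refine ⟨C₂ * (C₁ + 1), by positivity, fun d hd => ?_⟩
  have hgm := h.continuous.measurable
  set G := ∫ z, g (z * √(sigmaC φ m)) ∂stdG
  have hq : 0 < √(dmin d (m + 1) : ℝ) := Real.sqrt_pos.2 (by
    exact_mod_cast one_le_dmin fun j hj => hd j (by omega))
  have hq1 : √(dmin d (m + 1) : ℝ) ≤ √(dmin d m : ℝ) :=
    Real.sqrt_le_sqrt (by exact_mod_cast dmin_succ_le d m)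
  have hq2 : √(dmin d (m + 1) : ℝ) ≤ √(d (m + 1) : ℝ) :=
    Real.sqrt_le_sqrt (by exact_mod_cast dmin_le d le_rfl)
  rw [lintegral_preactivation φ hφ d hm (F := fun y => ENNReal.ofReal
    (|(1 / (d (m + 1) : ℝ)) * ∑ i, g (y i) - G| ^ k)) (by fun_prop)]
  calc _ ≤ ∫⁻ ω : (Fin (d 0) → ℝ) × Wspace d L, ENNReal.ofReal C₂ *
        (ENNReal.ofReal (|featSq φ d m ω - sigmaC φ m| ^ k) +
          ENNReal.ofReal (1 / √(d (m + 1) : ℝ) ^ k))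
        ∂((stdGPi (d 0)).prod (Wmeasure d L)) := by
        refine lintegral_mono fun ω => ?_
        rw [← ENNReal.ofReal_add (by positivity) (by positivity),
          ← ENNReal.ofReal_mul hC₂.le]
        exact h₂ _ (hd _ (by omega)) _ (featSq_nonneg φ d m ω)
    _ = ENNReal.ofReal C₂ * ((∫⁻ ω : (Fin (d 0) → ℝ) × Wspace d L,
        ENNReal.ofReal (|featSq φ d m ω - sigmaC φ m| ^ k)
          ∂((stdGPi (d 0)).prod (Wmeasure d L))) + ENNReal.ofReal (1 / √(d (m + 1) : ℝ) ^ k)) := by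
        rw [lintegral_const_mul' _ _ ENNReal.ofReal_ne_top, lintegral_add_right _ measurable_const]
        simp
    _ ≤ ENNReal.ofReal C₂ * (ENNReal.ofReal (C₁ / √(dmin d m : ℝ) ^ k) +
        ENNReal.ofReal (1 / √(d (m + 1) : ℝ) ^ k)) := by
        gcongr
        exact h₁ d hd
    _ = ENNReal.ofReal (C₂ * (C₁ / √(dmin d m : ℝ) ^ k + 1 / √(d (m + 1) : ℝ) ^ k)) := by
        rw [← ENNReal.ofReal_add (by positivity) (by positivity), ← ENNReal.ofReal_mul hC₂.le]
    _ ≤ _ := by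
        refine ENNReal.ofReal_le_ofReal ?_
        rw [mul_div_assoc, add_div]
        gcongr

lemma locLip_sq_id : LocLip 1 (fun x => x ^ 2) := fun a b => by
  rw [sq_sub_sq, abs_mul, one_mul, mul_comm]
  gcongr
  linarith [abs_add_le a b]

lemma integral_sq_stdG : ∫ z, z ^ 2 ∂stdG = 1 := by
  have h := variance_id_gaussianReal (μ := 0) (v := 1)
  rw [variance_of_integral_eq_zero (by fun_prop) (by simp)] at h
  simpa [stdG] using h

/-- Concentration of the empirical second moments of the post-activations. -/
lemma exists_moment_featSq_le {φ : ℝ → ℝ} (hφ : Measurable φ) {A : ℝ} (hA : 0 ≤ A)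
    (hφ2 : LocLip A (fun x => φ x ^ 2)) (hσ : ∀ m, 0 < sigmaC φ m) (L k m : ℕ) (hm : m ≤ L) :
    ∃ C > 0, ∀ d : ℕ → ℕ, (∀ j ≤ L, 1 ≤ d j) →
      ∫⁻ ω : (Fin (d 0) → ℝ) × Wspace d L, ENNReal.ofReal (|featSq φ d m ω - sigmaC φ m| ^ k)
        ∂((stdGPi (d 0)).prod (Wmeasure d L)) ≤ ENNReal.ofReal (C / √(dmin d m : ℝ) ^ k) := by
  induction m with
  | zero =>
    obtain ⟨C, hC, h⟩ := locLip_sq_id.exists_moment_mean_le zero_le_one one_pos k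
    refine ⟨C * ((0 : ℝ) ^ k + 1), by positivity, fun d hd => ?_⟩
    have h' := h (d 0) (hd 0 (by omega)) 1 zero_le_one
    simp only [Real.sqrt_one, one_mul, mul_one, integral_sq_stdG, sub_self, abs_zero] at h'
    have hdm : dmin d 0 = d 0 := by simp [dmin]
    have hs : 1 ≤ √(d 0 : ℝ) := Real.one_le_sqrt.2 (by exact_mod_cast hd 0 (by omega))
    rw [hdm, lintegral_prod _ (Measurable.aemeasurable (by
      refine ENNReal.measurable_ofReal.comp (Measurable.pow_const (Measurable.abs
        (Measurable.sub_const (Measurable.const_mul (Finset.measurable_fun_sum _ fun j _ =>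
          (measurable_feat hφ d 0 j).pow_const 2) _) _)) _)))]
    simp only [featSq, feat, sigmaC, lintegral_const, measure_univ, mul_one]
    refine h'.trans (ENNReal.ofReal_le_ofReal ?_)
    rw [mul_div_assoc, add_div]
    gcongr
    rcases Nat.eq_zero_or_pos k with rfl | hk
    · simp
    · simp [hk.ne']
  | succ m ih =>
    exact hφ2.exists_moment_layer_le hA hφ (by omega) (hσ m) k (ih (by omega))

lemma sigmaC_pos {φ : ℝ → ℝ} (hφ : Continuous φ) {A : ℝ} (hA : 0 ≤ A)
    (hφ2 : LocLip A (fun x => φ x ^ 2)) {x : ℝ} (hx : φ x ≠ 0) (m : ℕ) : 0 < sigmaC φ m := by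
  induction m with
  | zero => simp [sigmaC]
  | succ m ih =>
    have hs : 0 < √(sigmaC φ m) := Real.sqrt_pos.2 ih
    have hc : Continuous fun z => φ (z * √(sigmaC φ m)) ^ 2 := by fun_prop
    rw [sigmaC, integral_pos_iff_support_of_nonneg (fun z => sq_nonneg _)]
    · have hopen : IsOpen (Function.support fun z => φ (z * √(sigmaC φ m)) ^ 2) :=
        hc.isOpen_support
      have hne : (Function.support fun z => φ (z * √(sigmaC φ m)) ^ 2).Nonempty :=
        ⟨x / √(sigmaC φ m), by
          rw [Function.mem_support, div_mul_cancel₀ _ hs.ne']; exact pow_ne_zero 2 hx⟩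
      refine pos_iff_ne_zero.2 fun h0 => (hopen.measure_pos volume hne).ne' ?_
      exact gaussianReal_absolutelyContinuous' 0 one_ne_zero h0
    · refine ((integrable_one_add_sq_pow_stdG 1).const_mul
        (|φ 0 ^ 2| + A * (|√(sigmaC φ m)| + |√(sigmaC φ m)| ^ 2))).mono' hc.aestronglyMeasurable
        (.of_forall fun z => ?_)
      have := hφ2.abs_le hA (√(sigmaC φ m)) z
      rw [pow_one, mul_comm z]
      exact this

lemma abs_sub_le_of_abs_deriv_le {f : ℝ → ℝ} {K : ℝ} (hf : Differentiable ℝ f)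
    (hK : ∀ x, |deriv f x| ≤ K) (a b : ℝ) : |f a - f b| ≤ K * |a - b| :=
  convex_univ.norm_image_sub_le_of_norm_deriv_le (fun x _ => hf x) (fun x _ => hK x)
    (Set.mem_univ b) (Set.mem_univ a)

lemma locLip_of_lipschitz {f : ℝ → ℝ} {K : ℝ} (hK : 0 ≤ K)
    (hf : ∀ a b, |f a - f b| ≤ K * |a - b|) : LocLip K f := fun a b => by
  have : 0 ≤ K * |a - b| := by positivity
  nlinarith [hf a b, abs_nonneg a, abs_nonneg b]

lemma locLip_mul {f₁ f₂ : ℝ → ℝ} {K₁ K₂ : ℝ} (hK₁ : 0 ≤ K₁) (hK₂ : 0 ≤ K₂)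
    (h₁ : ∀ a b, |f₁ a - f₁ b| ≤ K₁ * |a - b|) (h₂ : ∀ a b, |f₂ a - f₂ b| ≤ K₂ * |a - b|)
    (h₁0 : f₁ 0 = 0) (h₂0 : f₂ 0 = 0) : LocLip (K₁ * K₂) (fun x => f₁ x * f₂ x) := fun a b => by
  have e₁ := h₁ b 0
  have e₂ := h₂ a 0
  simp only [h₁0, h₂0, sub_zero] at e₁ e₂
  calc |f₁ a * f₂ a - f₁ b * f₂ b| = |(f₁ a - f₁ b) * f₂ a + f₁ b * (f₂ a - f₂ b)| := by
        congr 1; ring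
    _ ≤ |f₁ a - f₁ b| * |f₂ a| + |f₁ b| * |f₂ a - f₂ b| := by
        rw [← abs_mul, ← abs_mul]; exact abs_add_le _ _
    _ ≤ K₁ * |a - b| * (K₂ * |a|) + K₁ * |b| * (K₂ * |a - b|) := by
        gcongr
        · exact h₁ a b
        · exact h₂ a b
    _ ≤ K₁ * K₂ * |a - b| * (1 + |a| + |b|) := by
        have : 0 ≤ K₁ * K₂ * |a - b| := by positivity
        nlinarith

/-- **Lemma C.1 (Post-activations moments).** For `g ∈ {φ², φ′, x ↦ xφ(x)}`, every
positive integer `k` and every layer `ℓ = m + 1 ∈ {1, …, L}`, there is `C_{k,φ} > 0`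
such that
`E|(1/d_ℓ) ∑_i g(W_i^{(ℓ)}·X^{(ℓ−1)}/√d_{ℓ−1}) − E g(Z√σ_{ℓ−1})|^k ≤ C_{k,φ}/d_{[0:ℓ]}^{k/2}`. -/
theorem post_activations_moments
    (L : ℕ) (hL : 1 ≤ L) (φ : ℝ → ℝ)
    (hφC2 : ContDiff ℝ 2 φ) (hφodd : ∀ x, φ (-x) = -φ x)
    (hφbd : ∃ K, ∀ x, |deriv φ x| ≤ K ∧ |deriv (deriv φ) x| ≤ K)
    (k : ℕ) (hk : 1 ≤ k) (m : ℕ) (hm : m + 1 ≤ L)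
    (g : ℝ → ℝ)
    (hg : g = (fun x => (φ x) ^ 2) ∨ g = deriv φ ∨ g = (fun x => x * φ x)) :
    ∃ C > 0, ∀ d : ℕ → ℕ, (∀ j ≤ L, 1 ≤ d j) →
      ∫ ω : (Fin (d 0) → ℝ) × Wspace d L,
          |(1 / (d (m + 1) : ℝ)) * ∑ i : Fin (d (m + 1)),
              g ((∑ j, extW ω.2 m i j * feat φ d (extW ω.2) ω.1 m j) /
                Real.sqrt (d m : ℝ)) -
            ∫ z, g (z * Real.sqrt (sigmaC φ m)) ∂stdG| ^ k
        ∂((stdGPi (d 0)).prod (Wmeasure d L)) ≤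
      C / (dmin d (m + 1) : ℝ) ^ ((k : ℝ) / 2) := by


  obtain ⟨K, hK⟩ := hφbd
  have hK0 : 0 ≤ K := (abs_nonneg _).trans (hK 0).1
  have hd1 : Differentiable ℝ φ := hφC2.differentiable two_ne_zero
  have hd2 : Differentiable ℝ (deriv φ) :=
    ((contDiff_succ_iff_deriv (n := 1)).1 hφC2).2.2.differentiable one_ne_zero
  have hφ0 : φ 0 = 0 := by have := hφodd 0; rw [neg_zero] at this; linarith
  have hlip := abs_sub_le_of_abs_deriv_le hd1 fun x => (hK x).1
  have hφ2 : LocLip (K * K) (fun x => φ x ^ 2) := by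
    simpa only [sq] using locLip_mul hK0 hK0 hlip hlip hφ0 hφ0
  obtain ⟨A, hA, hgl⟩ : ∃ A, 0 ≤ A ∧ LocLip A g := by
    rcases hg with rfl | rfl | rfl
    · exact ⟨_, mul_nonneg hK0 hK0, hφ2⟩
    · exact ⟨K, hK0, locLip_of_lipschitz hK0
        (abs_sub_le_of_abs_deriv_le hd2 fun x => (hK x).2)⟩
    · exact ⟨_, mul_nonneg zero_le_one hK0,
        locLip_mul zero_le_one hK0 (fun a b => (one_mul _).ge) hlip rfl hφ0⟩
  by_cases hφz : ∀ x, φ x = 0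
  · have hg0 : ∀ x, g x = 0 := by
      have hφz' : φ = fun _ => 0 := funext hφz
      rcases hg with rfl | rfl | rfl <;> simp [hφz']
    refine ⟨1, one_pos, fun d _ => ?_⟩
    simp only [hg0, Finset.sum_const_zero, mul_zero, integral_zero, sub_zero, abs_zero,
      zero_pow (by omega : k ≠ 0)]
    positivity
  push Not at hφz
  obtain ⟨x, hx⟩ := hφz
  have hφm := hd1.continuous.measurable
  have hσ := sigmaC_pos hd1.continuous (mul_nonneg hK0 hK0) hφ2 hx
  obtain ⟨C, hC, hbound⟩ := hgl.exists_moment_layer_le hA hφm hm (hσ m) k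
    (exists_moment_featSq_le hφm (mul_nonneg hK0 hK0) hφ2 hσ L k m (by omega))
  refine ⟨C, hC, fun d hd => ?_⟩
  have hmeas : Measurable fun ω : (Fin (d 0) → ℝ) × Wspace d L =>
      |(1 / (d (m + 1) : ℝ)) * ∑ i : Fin (d (m + 1)),
          g ((∑ j, extW ω.2 m i j * feat φ d (extW ω.2) ω.1 m j) / √(d m : ℝ)) -
        ∫ z, g (z * √(sigmaC φ m)) ∂stdG| ^ k := by
    refine ((((Finset.measurable_fun_sum _ fun i _ => hgl.continuous.measurable.comp
      (Measurable.div_const (Finset.measurable_fun_sum _ fun j _ => ?_) _)).const_mul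
        _).sub_const _).abs).pow_const k
    exact (measurable_extW_apply m i j).mul (measurable_feat hφm d m j)
  have hpow : (dmin d (m + 1) : ℝ) ^ ((k : ℝ) / 2) = √(dmin d (m + 1) : ℝ) ^ k := by
    rw [Real.sqrt_eq_rpow, ← Real.rpow_mul_natCast (Nat.cast_nonneg _)]
    congr 1; ring
  rw [hpow, integral_eq_lintegral_of_nonneg_ae (.of_forall fun ω => by positivity)
    hmeas.aestronglyMeasurable]
  exact ENNReal.toReal_le_of_le_ofReal (by positivity) (hbound d hd)

end
end

section
/- Properties of the output kernel (Lemma D.2). Let S_1,…,S_n be real random variables, and conditionally on them let Y_μ = f(S_μ;A_μ) + √Δ Z_μ with A_μ i.i.d. P_A and Z_μ i.i.d. N(0,1), all independent across μ and of the S's. Write u_y(x) = log P_out(y|x), u′_μ = ∂_x u_{Y_μ}(x)|_{x=S_μ} (and similarly u″_μ, u‴_μ), U_{μν} = δ_{μν}u″_μ + u′_μ u′_ν, and U_{μνη} = u‴_μ δ_{μν}δ_{νη} + u″_μ u′_ν δ_{μη} + u′_μ u″_ν δ_{νη} + u′_μ u′_ν u′_η. If f(·;A) ∈ C²(ℝ)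 has first and second derivatives bounded uniformly in A, then: E[u′_μ | S_μ] = 0; E[U_{μν} | S_μ, S_ν] = 0 for all μ, ν; E[U_{μνη} | S_μ, S_ν, S_η] = 0 whenever μ ≠ ν; and there exist constants C(f), C′(f) > 0 with E[(u′_μ)² | S_μ] ≤ C(f), E[U_{μν}² | S_μ, S_ν] ≤ C(f), and E[U_{μνη}² | S_μ, S_ν, S_η] ≤ C′(f) whenever μ ≠ ν. -/
open MeasureTheory ProbabilityTheory

noncomputable section

/-- `u′_y(x) = ∂_x log P_out(y|x)`. -/
def uD1 {p : ℕ} (PA : Measure (Fin p → ℝ)) (Δ : ℝ) (f : ℝ → (Fin p → ℝ) → ℝ)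
    (y x : ℝ) : ℝ := deriv (fun x' => Real.log (Pout PA Δ f y x')) x

/-- `u″_y(x)`. -/
def uD2 {p : ℕ} (PA : Measure (Fin p → ℝ)) (Δ : ℝ) (f : ℝ → (Fin p → ℝ) → ℝ)
    (y x : ℝ) : ℝ := deriv (deriv (fun x' => Real.log (Pout PA Δ f y x'))) x

/-- `u‴_y(x)`. -/
def uD3 {p : ℕ} (PA : Measure (Fin p → ℝ)) (Δ : ℝ) (f : ℝ → (Fin p → ℝ) → ℝ)
    (y x : ℝ) : ℝ := deriv (deriv (deriv (fun x' => Real.log (Pout PA Δ f y x')))) x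

/-- Law of the channel randomness `(A_μ, Z_μ)_{μ=1}^n`. -/
def chanMeasure (p : ℕ) (PA : Measure (Fin p → ℝ)) [IsProbabilityMeasure PA] (n : ℕ) :
    Measure (Fin n → (Fin p → ℝ) × ℝ) :=
  Measure.pi fun _ => PA.prod stdG

/-- Responses given the values `S_μ` of the signals: `Y_μ = f(S_μ;A_μ) + √Δ Z_μ`. -/
def Ych {p : ℕ} (Δ : ℝ) (f : ℝ → (Fin p → ℝ) → ℝ) {n : ℕ} (S : Fin n → ℝ)
    (ωc : Fin n → (Fin p → ℝ) × ℝ) (μ : Fin n) : ℝ :=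
  f (S μ) (ωc μ).1 + Real.sqrt Δ * (ωc μ).2

/-- Kronecker delta. -/
def kd {n : ℕ} (μ ν : Fin n) : ℝ := if μ = ν then 1 else 0

/-- `u′_μ`. -/
def uP {p : ℕ} (PA : Measure (Fin p → ℝ)) (Δ : ℝ) (f : ℝ → (Fin p → ℝ) → ℝ) {n : ℕ}
    (S : Fin n → ℝ) (ωc : Fin n → (Fin p → ℝ) × ℝ) (μ : Fin n) : ℝ :=
  uD1 PA Δ f (Ych Δ f S ωc μ) (S μ)

/-- `u″_μ`. -/
def uPP {p : ℕ} (PA : Measure (Fin p → ℝ)) (Δ : ℝ) (f : ℝ → (Fin p → ℝ) → ℝ) {n : ℕ}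
    (S : Fin n → ℝ) (ωc : Fin n → (Fin p → ℝ) × ℝ) (μ : Fin n) : ℝ :=
  uD2 PA Δ f (Ych Δ f S ωc μ) (S μ)

/-- `u‴_μ`. -/
def uPPP {p : ℕ} (PA : Measure (Fin p → ℝ)) (Δ : ℝ) (f : ℝ → (Fin p → ℝ) → ℝ) {n : ℕ}
    (S : Fin n → ℝ) (ωc : Fin n → (Fin p → ℝ) × ℝ) (μ : Fin n) : ℝ :=
  uD3 PA Δ f (Ych Δ f S ωc μ) (S μ)

/-- `U_{μν} = δ_{μν} u″_μ + u′_μ u′_ν`. -/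
def Upair {p : ℕ} (PA : Measure (Fin p → ℝ)) (Δ : ℝ) (f : ℝ → (Fin p → ℝ) → ℝ) {n : ℕ}
    (S : Fin n → ℝ) (ωc : Fin n → (Fin p → ℝ) × ℝ) (μ ν : Fin n) : ℝ :=
  kd μ ν * uPP PA Δ f S ωc μ + uP PA Δ f S ωc μ * uP PA Δ f S ωc ν

/-- `U_{μνη} = u‴_μ δ_{μν}δ_{νη} + u″_μ u′_ν δ_{μη} + u′_μ u″_ν δ_{νη} + u′_μ u′_ν u′_η`. -/
def Utriple {p : ℕ} (PA : Measure (Fin p → ℝ)) (Δ : ℝ) (f : ℝ → (Fin p → ℝ) → ℝ) {n : ℕ}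
    (S : Fin n → ℝ) (ωc : Fin n → (Fin p → ℝ) × ℝ) (μ ν η : Fin n) : ℝ :=
  uPPP PA Δ f S ωc μ * kd μ ν * kd ν η +
    uPP PA Δ f S ωc μ * uP PA Δ f S ωc ν * kd μ η +
    uP PA Δ f S ωc μ * uPP PA Δ f S ωc ν * kd ν η +
    uP PA Δ f S ωc μ * uP PA Δ f S ωc ν * uP PA Δ f S ωc η

/-- The quadratic weight `b₂ (t² - v) + b₁ t`, which has mean zero under `N(0, v)`. -/
def hermiteWeight (v : NNReal) (b₁ b₂ t : ℝ) : ℝ := b₂ * (t ^ 2 - v) + b₁ * t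

lemma hermiteWeight_sq_le (v : NNReal) {B b₁ b₂ : ℝ} (h₁ : |b₁| ≤ B) (h₂ : |b₂| ≤ B) (t : ℝ) :
    hermiteWeight v b₁ b₂ t ^ 2 ≤ 2 * B ^ 2 * ((t ^ 2 - v) ^ 2 + t ^ 2) := by
  have h₁' : b₁ ^ 2 ≤ B ^ 2 := sq_le_sq' (abs_le.1 h₁).1 (abs_le.1 h₁).2
  have h₂' : b₂ ^ 2 ≤ B ^ 2 := sq_le_sq' (abs_le.1 h₂).1 (abs_le.1 h₂).2
  have := add_sq_le (a := b₂ * (t ^ 2 - v)) (b := b₁ * t)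
  unfold hermiteWeight
  nlinarith [mul_le_mul_of_nonneg_right h₁' (sq_nonneg t),
    mul_le_mul_of_nonneg_right h₂' (sq_nonneg (t ^ 2 - v))]

lemma hermiteWeight_sq_le_quartic (v : NNReal) {B b₁ b₂ : ℝ} (h₁ : |b₁| ≤ B) (h₂ : |b₂| ≤ B)
    (t : ℝ) :
    hermiteWeight v b₁ b₂ t ^ 2 ≤ (1 + 2 * B ^ 2 * (2 + v ^ 2)) * (1 + t ^ 4) - 1 := by
  have h := hermiteWeight_sq_le v h₁ h₂ t
  have hq : (t ^ 2 - v) ^ 2 + t ^ 2 ≤ (2 + (v : ℝ) ^ 2) * (1 + t ^ 4) := by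
    nlinarith [mul_nonneg v.coe_nonneg (sq_nonneg t), sq_nonneg (t ^ 2 - 1),
      sq_nonneg ((v : ℝ) * t ^ 2), sq_nonneg (t ^ 2)]
  have := mul_le_mul_of_nonneg_left hq (by positivity : 0 ≤ 2 * B ^ 2)
  have : 0 ≤ t ^ 4 := by positivity
  linarith

lemma abs_hermiteWeight_le_quartic (v : NNReal) {B b₁ b₂ : ℝ} (h₁ : |b₁| ≤ B) (h₂ : |b₂| ≤ B)
    (t : ℝ) :
    |hermiteWeight v b₁ b₂ t| ≤ (1 + 2 * B ^ 2 * (2 + v ^ 2)) * (1 + t ^ 4) := by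
  have h := hermiteWeight_sq_le_quartic v h₁ h₂ t
  nlinarith [sq_abs (hermiteWeight v b₁ b₂ t), sq_nonneg (|hermiteWeight v b₁ b₂ t| - 1)]

lemma integrable_pow_gaussianReal (v : NNReal) (k : ℕ) :
    Integrable (fun t : ℝ => t ^ k) (gaussianReal 0 v) := by
  have h := (memLp_id_gaussianReal (μ := 0) (v := v) k).integrable_norm_pow'
  simp only [id, ← norm_pow] at h
  exact (integrable_norm_iff (by fun_prop)).1 h

lemma integral_hermiteWeight (v : NNReal) (b₁ b₂ : ℝ) :
    ∫ t, hermiteWeight v b₁ b₂ t ∂(gaussianReal 0 v) = 0 := by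
  have h1 : Integrable (fun t : ℝ => t) (gaussianReal 0 v) := by
    simpa using integrable_pow_gaussianReal v 1
  have h2 := integrable_pow_gaussianReal v 2
  have hvar : ∫ t : ℝ, t ^ 2 ∂(gaussianReal 0 v) = v := by
    have h := variance_fun_id_gaussianReal (μ := 0) (v := v)
    rw [variance_eq_integral (by fun_prop)] at h
    simpa using h
  unfold hermiteWeight
  have h3 : Integrable (fun t : ℝ => t ^ 2 - (v : ℝ)) (gaussianReal 0 v) :=
    h2.sub (integrable_const _)
  rw [integral_add (h3.const_mul _) (h1.const_mul _),
    integral_const_mul, integral_const_mul, integral_sub h2 (integrable_const _), hvar,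
    integral_id_gaussianReal]
  simp

lemma exists_quartic_mul_gaussianPDFReal_le (v : NNReal) :
    ∃ M, ∀ t : ℝ, (1 + t ^ 4) * gaussianPDFReal 0 v t ≤ M := by
  refine ⟨(1 + 8 * v ^ 2) * (√(2 * Real.pi * v))⁻¹, fun t => ?_⟩
  rcases eq_or_ne v 0 with rfl | hv
  · simp
  have hv' : (0 : ℝ) < v := by positivity
  have hs : 0 ≤ t ^ 2 / (2 * v) := by positivity
  have h4 := Real.pow_div_factorial_le_exp _ hs 2
  have h0 := Real.one_le_exp hs
  have key : (1 + t ^ 4) ≤ (1 + 8 * v ^ 2) * Real.exp (t ^ 2 / (2 * v)) := by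
    have : t ^ 4 = 8 * v ^ 2 * ((t ^ 2 / (2 * v)) ^ 2 / (Nat.factorial 2 : ℝ)) := by
      simp only [Nat.factorial]
      field_simp
      norm_num [mul_assoc]
    nlinarith [mul_le_mul_of_nonneg_left h4 (by positivity : 0 ≤ 8 * (v : ℝ) ^ 2)]
  simp only [gaussianPDFReal_def, sub_zero, neg_div, Real.exp_neg]
  calc (1 + t ^ 4) * ((√(2 * Real.pi * v))⁻¹ * (Real.exp (t ^ 2 / (2 * v)))⁻¹)
      = ((1 + t ^ 4) / Real.exp (t ^ 2 / (2 * v))) * (√(2 * Real.pi * v))⁻¹ := by ring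
    _ ≤ _ := by
      gcongr
      rwa [div_le_iff₀ (Real.exp_pos _)]

lemma integrable_quartic_mul_gaussianPDFReal {v : NNReal} (hv : v ≠ 0) :
    Integrable (fun t : ℝ => (1 + t ^ 4) * gaussianPDFReal 0 v t) := by
  have h := (integrable_const (1 : ℝ)).add (integrable_pow_gaussianReal v 4)
  rw [gaussianReal_of_var_ne_zero _ hv, integrable_withDensity_iff_integrable_smul'
    (measurable_gaussianPDF _ _) (ae_of_all _ fun _ => gaussianPDF_lt_top)] at h
  refine h.congr (ae_of_all _ fun t => ?_)
  simp [toReal_gaussianPDF, mul_comm]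

lemma abs_mul_gaussianPDFReal_le {α : Type*} {h : α → ℝ → ℝ} {c : ℝ} {v : NNReal}
    (hb : ∀ a t, |h a t| ≤ c * (1 + t ^ 4)) (a : α) (t : ℝ) :
    |h a t * gaussianPDFReal 0 v t| ≤ c * ((1 + t ^ 4) * gaussianPDFReal 0 v t) := by
  have h0 := gaussianPDFReal_nonneg 0 v t
  rw [abs_mul, abs_of_nonneg h0, ← mul_assoc]
  exact mul_le_mul_of_nonneg_right (hb a t) h0

lemma nonneg_of_abs_le_quartic {α : Type*} [Nonempty α] {h : α → ℝ → ℝ} {c : ℝ}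
    (hb : ∀ a t, |h a t| ≤ c * (1 + t ^ 4)) : 0 ≤ c := by
  obtain ⟨a⟩ := ‹Nonempty α›
  simpa using (abs_nonneg _).trans (hb a 0)

lemma abs_one_le_quartic (t : ℝ) : |(1 : ℝ)| ≤ 1 * (1 + t ^ 4) := by
  have : 0 ≤ t ^ 4 := by positivity
  simpa using this

section Channel

variable {α : Type*} [MeasurableSpace α] (P : Measure α) [IsProbabilityMeasure P]

/-- Average over `a` of `h a (y - m a)` weighted by the density of `N(m a, v)` at `y`. -/
def channelAvg (v : NNReal) (m : α → ℝ) (h : α → ℝ → ℝ) (y : ℝ) : ℝ :=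
  ∫ a, h a (y - m a) * gaussianPDFReal 0 v (y - m a) ∂P

variable {v : NNReal} {m : α → ℝ} {h : α → ℝ → ℝ} {c : ℝ}

lemma measurable_mul_gaussianPDFReal (hm : Measurable m) (hh : Measurable (Function.uncurry h)) :
    Measurable fun q : α × ℝ => h q.1 (q.2 - m q.1) * gaussianPDFReal 0 v (q.2 - m q.1) := by
  have h1 : Measurable fun q : α × ℝ => q.2 - m q.1 := by fun_prop
  exact (hh.comp (measurable_fst.prodMk h1)).mul ((measurable_gaussianPDFReal 0 v).comp h1)

lemma integrable_channelAvg_slice (hm : Measurable m) (hh : Measurable (Function.uncurry h))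
    (hb : ∀ a t, |h a t| ≤ c * (1 + t ^ 4)) (y : ℝ) :
    Integrable (fun a => h a (y - m a) * gaussianPDFReal 0 v (y - m a)) P := by
  obtain ⟨M, hM⟩ := exists_quartic_mul_gaussianPDFReal_le v
  have := P.nonempty_of_neZero
  have hc := nonneg_of_abs_le_quartic hb
  refine Integrable.of_bound (C := c * M) ((measurable_mul_gaussianPDFReal hm hh).comp
    (measurable_id.prodMk measurable_const)).aestronglyMeasurable (ae_of_all _ fun a => ?_)
  exact (abs_mul_gaussianPDFReal_le hb a _).trans (mul_le_mul_of_nonneg_left (hM _) hc)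

lemma integrable_prod_channelAvg (hv : v ≠ 0) (hm : Measurable m)
    (hh : Measurable (Function.uncurry h)) (hb : ∀ a t, |h a t| ≤ c * (1 + t ^ 4)) :
    Integrable (fun q : α × ℝ => h q.1 (q.2 - m q.1) * gaussianPDFReal 0 v (q.2 - m q.1))
      (P.prod volume) := by
  have hshear : MeasurePreserving (fun q : α × ℝ => (q.1, q.2 - m q.1))
      (P.prod volume) (P.prod volume) :=
    (MeasurePreserving.id P).skew_product (g := fun a y => y - m a)
      (by simp only [Function.uncurry_def]; fun_prop)
      (ae_of_all _ fun a => (measurePreserving_sub_right volume (m a)).map_eq)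
  have hdom : Integrable (fun q : α × ℝ => c * ((1 + q.2 ^ 4) * gaussianPDFReal 0 v q.2))
      (P.prod volume) :=
    ((integrable_quartic_mul_gaussianPDFReal hv).comp_snd P).const_mul c
  refine hshear.integrable_comp_of_integrable
    (g := fun q : α × ℝ => h q.1 q.2 * gaussianPDFReal 0 v q.2) (hdom.mono' ?_ ?_)
  · exact (hh.mul ((measurable_gaussianPDFReal 0 v).comp measurable_snd)).aestronglyMeasurable
  · exact ae_of_all _ fun q => abs_mul_gaussianPDFReal_le hb q.1 q.2

lemma integrable_channelAvg (hv : v ≠ 0) (hm : Measurable m)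
    (hh : Measurable (Function.uncurry h)) (hb : ∀ a t, |h a t| ≤ c * (1 + t ^ 4)) :
    Integrable (channelAvg P v m h) :=
  (integrable_prod_channelAvg P hv hm hh hb).integral_prod_right

lemma integral_channelAvg (hv : v ≠ 0) (hm : Measurable m)
    (hh : Measurable (Function.uncurry h)) (hb : ∀ a t, |h a t| ≤ c * (1 + t ^ 4)) :
    ∫ y, channelAvg P v m h y = ∫ a, ∫ t, h a t ∂(gaussianReal 0 v) ∂P := by
  unfold channelAvg
  rw [← integral_integral_swap (f := fun a y =>
    h a (y - m a) * gaussianPDFReal 0 v (y - m a)) (integrable_prod_channelAvg P hv hm hh hb)]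
  refine integral_congr_ae (ae_of_all _ fun a => ?_)
  simp only
  rw [integral_sub_right_eq_self (fun t => h a t * gaussianPDFReal 0 v t),
    integral_gaussianReal_eq_integral_smul hv]
  simp [mul_comm]

lemma measurable_channelAvg (hm : Measurable m) (hh : Measurable (Function.uncurry h)) :
    Measurable (channelAvg P v m h) :=
  ((measurable_mul_gaussianPDFReal hm hh).stronglyMeasurable.integral_prod_left).measurable

/-- Marginal density at `y` of the noisy observation `m a + N(0, v)`. -/
abbrev channelDensity (v : NNReal) (m : α → ℝ) : ℝ → ℝ := channelAvg P v m fun _ _ => 1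

lemma channelDensity_pos (hv : v ≠ 0) (hm : Measurable m) (y : ℝ) : 0 < channelDensity P v m y := by
  have hi := integrable_channelAvg_slice P (v := v) hm (h := fun _ _ => 1) measurable_const
    (fun _ => abs_one_le_quartic) y
  have hpos (a : α) : 0 < 1 * gaussianPDFReal 0 v (y - m a) := by
    simpa using gaussianPDFReal_pos 0 v _ hv
  refine (integral_pos_iff_support_of_nonneg (fun a => (hpos a).le) hi).2 ?_
  rw [Function.support_eq_univ fun a => (hpos a).ne']
  simp

lemma map_channel (hv : v ≠ 0) (hm : Measurable m) :
    (P.prod (gaussianReal 0 1)).map (fun ω : α × ℝ => m ω.1 + √v * ω.2) =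
      volume.withDensity fun y => ENNReal.ofReal (channelDensity P v m y) := by
  have hY : Measurable fun ω : α × ℝ => m ω.1 + √v * ω.2 := by fun_prop
  ext s hs
  rw [Measure.map_apply hY hs, Measure.prod_apply (hY hs), withDensity_apply _ hs]
  have hslice (a : α) : gaussianReal 0 1 (Prod.mk a ⁻¹' ((fun ω : α × ℝ => m ω.1 + √v * ω.2) ⁻¹' s))
      = ∫⁻ y in s, ENNReal.ofReal (1 * gaussianPDFReal 0 v (y - m a)) := by
    have hmap : (gaussianReal 0 1).map (fun z => m a + √v * z) = gaussianReal (m a) v := by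
      have h1 := gaussianReal_map_const_mul (μ := 0) (v := 1) (√v)
      have h2 := gaussianReal_map_const_add (μ := √v * 0) (v := v) (m a)
      have hsq : NNReal.mk (√v ^ 2) (sq_nonneg _) * 1 = v := by
        ext
        simp
      rw [hsq] at h1
      rw [← h1, Measure.map_map (by fun_prop) (by fun_prop)] at h2
      simpa [Function.comp_def] using h2
    rw [← Set.preimage_comp]
    change gaussianReal 0 1 ((fun z => m a + √v * z) ⁻¹' s) = _
    rw [← Measure.map_apply (by fun_prop) hs, hmap, gaussianReal_apply _ hv]
    simp [gaussianPDF, gaussianPDFReal_sub]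
  simp_rw [hslice]
  have hmeas : Measurable fun q : α × ℝ => 1 * gaussianPDFReal 0 v (q.2 - m q.1) :=
    measurable_mul_gaussianPDFReal (h := fun _ _ => 1) hm measurable_const
  rw [lintegral_lintegral_swap (hmeas.ennreal_ofReal.aemeasurable)]
  refine lintegral_congr fun y => ?_
  exact (ofReal_integral_eq_lintegral_ofReal (integrable_channelAvg_slice P (h := fun _ _ => 1) hm
    measurable_const (fun _ => abs_one_le_quartic) y)
    (ae_of_all _ fun a => mul_nonneg zero_le_one (gaussianPDFReal_nonneg _ _ _))).symm

lemma integral_comp_channel (hv : v ≠ 0) (hm : Measurable m) {g : ℝ → ℝ} (hg : Measurable g) :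
    ∫ ω : α × ℝ, g (m ω.1 + √v * ω.2) ∂(P.prod (gaussianReal 0 1)) =
      ∫ y, channelDensity P v m y * g y := by
  have hY : Measurable fun ω : α × ℝ => m ω.1 + √v * ω.2 := by fun_prop
  rw [← integral_map hY.aemeasurable hg.aestronglyMeasurable, map_channel P hv hm,
    integral_withDensity_eq_integral_toReal_smul
      (measurable_channelAvg P hm measurable_const).ennreal_ofReal
      (ae_of_all _ fun _ => ENNReal.ofReal_lt_top)]
  refine integral_congr_ae (ae_of_all _ fun y => ?_)
  simp [ENNReal.toReal_ofReal (channelDensity_pos P hv hm y).le]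

lemma integral_channel_ratio (hv : v ≠ 0) (hm : Measurable m)
    (hh : Measurable (Function.uncurry h)) (hb : ∀ a t, |h a t| ≤ c * (1 + t ^ 4)) :
    ∫ ω : α × ℝ, channelAvg P v m h (m ω.1 + √v * ω.2) /
        channelDensity P v m (m ω.1 + √v * ω.2) ∂(P.prod (gaussianReal 0 1)) =
      ∫ a, ∫ t, h a t ∂(gaussianReal 0 v) ∂P := by
  rw [integral_comp_channel P hv hm (g := fun y => channelAvg P v m h y / channelDensity P v m y)
    ((measurable_channelAvg P hm hh).div (measurable_channelAvg P hm measurable_const)),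
    ← integral_channelAvg P hv hm hh hb]
  refine integral_congr_ae (ae_of_all _ fun y => ?_)
  exact mul_div_cancel₀ _ (channelDensity_pos P hv hm y).ne'

lemma channelDensity_mul_ratio_sq_le (hv : v ≠ 0) (hm : Measurable m)
    (hh : Measurable (Function.uncurry h)) (hb : ∀ a t, |h a t| ≤ c * (1 + t ^ 4))
    (hb2 : ∀ a t, |h a t ^ 2| ≤ c * (1 + t ^ 4)) (y : ℝ) :
    channelDensity P v m y * (channelAvg P v m h y / channelDensity P v m y) ^ 2 ≤
      channelAvg P v m (fun a t => h a t ^ 2) y := by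
  have hpos := channelDensity_pos P hv hm y
  have i0 := integrable_channelAvg_slice P (v := v) (h := fun _ _ => 1) hm measurable_const
    (fun _ => abs_one_le_quartic) y
  have i1 := integrable_channelAvg_slice P (v := v) hm hh hb y
  have i2 := integrable_channelAvg_slice P (v := v) (h := fun a t => h a t ^ 2) hm
    (hh.pow_const 2) hb2 y
  set r := channelAvg P v m h y / channelDensity P v m y with hr
  have hN : channelAvg P v m h y = r * channelDensity P v m y := by
    rw [hr, div_mul_cancel₀ _ hpos.ne']
  have key : 0 ≤ ∫ a, (h a (y - m a) ^ 2 * gaussianPDFReal 0 v (y - m a)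
      - 2 * r * (h a (y - m a) * gaussianPDFReal 0 v (y - m a)))
      + r ^ 2 * (1 * gaussianPDFReal 0 v (y - m a)) ∂P := by
    refine integral_nonneg fun a => ?_
    have := mul_nonneg (sq_nonneg (h a (y - m a) - r)) (gaussianPDFReal_nonneg 0 v (y - m a))
    simp only [Pi.zero_apply]
    linarith
  have i12 : Integrable (fun a => h a (y - m a) ^ 2 * gaussianPDFReal 0 v (y - m a)
      - 2 * r * (h a (y - m a) * gaussianPDFReal 0 v (y - m a))) P := i2.sub (i1.const_mul _)
  rw [integral_add i12 (i0.const_mul _),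
    integral_sub i2 (i1.const_mul (2 * r)), integral_const_mul, integral_const_mul] at key
  change 0 ≤ channelAvg P v m (fun a t => h a t ^ 2) y - 2 * r * channelAvg P v m h y
    + r ^ 2 * channelDensity P v m y at key
  rw [hN] at key
  linarith

lemma integral_channel_ratio_sq_le (hv : v ≠ 0) (hm : Measurable m)
    (hh : Measurable (Function.uncurry h)) (hb : ∀ a t, |h a t| ≤ c * (1 + t ^ 4))
    (hb2 : ∀ a t, |h a t ^ 2| ≤ c * (1 + t ^ 4)) :
    ∫ ω : α × ℝ, (channelAvg P v m h (m ω.1 + √v * ω.2) /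
        channelDensity P v m (m ω.1 + √v * ω.2)) ^ 2 ∂(P.prod (gaussianReal 0 1)) ≤
      ∫ a, ∫ t, h a t ^ 2 ∂(gaussianReal 0 v) ∂P := by
  rw [integral_comp_channel P hv hm
    (g := fun y => (channelAvg P v m h y / channelDensity P v m y) ^ 2)
    (((measurable_channelAvg P hm hh).div (measurable_channelAvg P hm measurable_const)).pow_const
      2), ← integral_channelAvg P hv hm (h := fun a t => h a t ^ 2) (hh.pow_const 2) hb2]
  refine integral_mono_of_nonneg (ae_of_all _ fun y => ?_)
    (integrable_channelAvg P hv hm (h := fun a t => h a t ^ 2) (hh.pow_const 2) hb2)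
    (ae_of_all _ fun y => channelDensity_mul_ratio_sq_le P hv hm hh hb hb2 y)
  exact mul_nonneg (channelDensity_pos P hv hm y).le (sq_nonneg _)

end Channel

section HermiteChannel

variable {α : Type*} [MeasurableSpace α] (P : Measure α) [IsProbabilityMeasure P]
  {v : NNReal} {m b₁ b₂ : α → ℝ} {B : ℝ}

lemma measurable_hermiteWeight (h₁ : Measurable b₁) (h₂ : Measurable b₂) :
    Measurable (Function.uncurry fun a t => hermiteWeight v (b₁ a) (b₂ a) t) := by
  simp only [Function.uncurry_def, hermiteWeight]
  fun_prop

lemma integral_hermite_ratio (hv : v ≠ 0) (hm : Measurable m) (hb₁ : Measurable b₁)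
    (hb₂ : Measurable b₂) (h₁ : ∀ a, |b₁ a| ≤ B) (h₂ : ∀ a, |b₂ a| ≤ B) :
    ∫ ω : α × ℝ, channelAvg P v m (fun a => hermiteWeight v (b₁ a) (b₂ a)) (m ω.1 + √v * ω.2) /
        channelDensity P v m (m ω.1 + √v * ω.2) ∂(P.prod (gaussianReal 0 1)) = 0 := by
  rw [integral_channel_ratio P hv hm (measurable_hermiteWeight hb₁ hb₂)
    fun a t => abs_hermiteWeight_le_quartic v (h₁ a) (h₂ a) t]
  simp [integral_hermiteWeight]

lemma integral_hermite_ratio_sq_le (hv : v ≠ 0) (hm : Measurable m) (hb₁ : Measurable b₁)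
    (hb₂ : Measurable b₂) (h₁ : ∀ a, |b₁ a| ≤ B) (h₂ : ∀ a, |b₂ a| ≤ B) :
    ∫ ω : α × ℝ, (channelAvg P v m (fun a => hermiteWeight v (b₁ a) (b₂ a)) (m ω.1 + √v * ω.2) /
        channelDensity P v m (m ω.1 + √v * ω.2)) ^ 2 ∂(P.prod (gaussianReal 0 1)) ≤
      2 * B ^ 2 * ∫ t : ℝ, ((t ^ 2 - v) ^ 2 + t ^ 2) ∂(gaussianReal 0 v) := by
  refine (integral_channel_ratio_sq_le P hv hm (measurable_hermiteWeight hb₁ hb₂)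
    (fun a t => abs_hermiteWeight_le_quartic v (h₁ a) (h₂ a) t) fun a t => ?_).trans ?_
  · rw [abs_of_nonneg (sq_nonneg _)]
    exact (hermiteWeight_sq_le_quartic v (h₁ a) (h₂ a) t).trans (sub_le_self _ zero_le_one)
  have hint : Integrable (fun t : ℝ => (t ^ 2 - (v : ℝ)) ^ 2 + t ^ 2) (gaussianReal 0 v) := by
    have := (((integrable_pow_gaussianReal v 4).sub
      ((integrable_pow_gaussianReal v 2).const_mul (2 * v))).add
      (integrable_const ((v : ℝ) ^ 2))).add (integrable_pow_gaussianReal v 2)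
    refine this.congr (ae_of_all _ fun t => ?_)
    simp only [Pi.add_apply, Pi.sub_apply]
    ring
  have hslice (a : α) : ∫ t, hermiteWeight v (b₁ a) (b₂ a) t ^ 2 ∂(gaussianReal 0 v) ≤
      2 * B ^ 2 * ∫ t : ℝ, ((t ^ 2 - v) ^ 2 + t ^ 2) ∂(gaussianReal 0 v) := by
    rw [← integral_const_mul]
    exact integral_mono_of_nonneg (ae_of_all _ fun t => sq_nonneg _) (hint.const_mul _)
      (ae_of_all _ fun t => hermiteWeight_sq_le v (h₁ a) (h₂ a) t)
  refine (integral_mono_of_nonneg (ae_of_all _ fun a => integral_nonneg fun t => sq_nonneg _)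
    (integrable_const _) (ae_of_all _ hslice)).trans ?_
  simp

lemma measurable_of_hasDerivAt {F : ℝ → α → ℝ} {F' : α → ℝ} {x : ℝ} (hF : ∀ x, Measurable (F x))
    (hderiv : ∀ a, HasDerivAt (F · a) (F' a) x) : Measurable F' :=
  measurable_of_tendsto_metrizable' (f := fun (t : ℝ) a => t⁻¹ • (F (x + t) a - F x a))
    (nhdsWithin 0 {0}ᶜ) (fun t => by have h₁ := hF (x + t); have h₂ := hF x; fun_prop)
    (tendsto_pi_nhds.2 fun a => (hderiv a).tendsto_slope_zero)

lemma hasDerivAt_integral_of_bounded {F F' : ℝ → α → ℝ} {C : ℝ} (hF : ∀ x, Measurable (F x))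
    (hderiv : ∀ x a, HasDerivAt (F · a) (F' x a) x) (hb : ∀ x a, |F x a| ≤ C)
    (hb' : ∀ x a, |F' x a| ≤ C) (x : ℝ) :
    HasDerivAt (fun x => ∫ a, F x a ∂P) (∫ a, F' x a ∂P) x := by
  have hF' : Measurable (F' x) := measurable_of_hasDerivAt hF (hderiv x)
  exact (hasDerivAt_integral_of_dominated_loc_of_deriv_le (bound := fun _ => C) Filter.univ_mem
    (Filter.Eventually.of_forall fun x => (hF x).aestronglyMeasurable)
    (Integrable.of_bound (hF x).aestronglyMeasurable C (ae_of_all _ (hb x)))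
    hF'.aestronglyMeasurable (ae_of_all _ fun a x _ => hb' x a) (integrable_const C)
    (ae_of_all _ fun a x _ => hderiv x a)).2

lemma hasDerivAt_gaussianPDFReal (v : NNReal) (t : ℝ) :
    HasDerivAt (gaussianPDFReal 0 v) (-(t / v) * gaussianPDFReal 0 v t) t := by
  rw [gaussianPDFReal_def]
  have h := ((((hasDerivAt_id t).sub_const 0).pow 2).neg.div_const (2 * (v : ℝ))).exp.const_mul
    (√(2 * Real.pi * v))⁻¹
  refine h.congr_deriv ?_
  rcases eq_or_ne v 0 with rfl | hv
  · simp
  have hv' : (v : ℝ) ≠ 0 := by simpa using hv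
  simp
  field_simp

lemma hasDerivAt_channelAvg {F : ℝ → α → ℝ} {F' : ℝ → α → ℝ} {h h' : ℝ → α → ℝ → ℝ} {c : ℝ}
    (hF : ∀ x, Measurable (F x)) (hderiv : ∀ x a, HasDerivAt (F · a) (F' x a) x)
    (hh : ∀ x, Measurable (Function.uncurry (h x)))
    (hb : ∀ x a t, |h x a t| ≤ c * (1 + t ^ 4)) (hb' : ∀ x a t, |h' x a t| ≤ c * (1 + t ^ 4))
    (y : ℝ)
    (hweight : ∀ x a, HasDerivAt (fun x => h x a (y - F x a))
      (h' x a (y - F x a) - h x a (y - F x a) * ((y - F x a) * F' x a / v)) x) (x : ℝ) :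
    HasDerivAt (fun x => channelAvg P v (F x) (h x) y) (channelAvg P v (F x) (h' x) y) x := by
  obtain ⟨M, hM⟩ := exists_quartic_mul_gaussianPDFReal_le v
  have := P.nonempty_of_neZero
  have hc := nonneg_of_abs_le_quartic (hb 0)
  refine hasDerivAt_integral_of_bounded P (C := c * M)
    (F := fun x a => h x a (y - F x a) * gaussianPDFReal 0 v (y - F x a))
    (F' := fun x a => h' x a (y - F x a) * gaussianPDFReal 0 v (y - F x a))
    (fun x => (measurable_mul_gaussianPDFReal (hF x) (hh x)).comp
      (measurable_id.prodMk measurable_const)) (fun x a => ?_)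
    (fun x a => (abs_mul_gaussianPDFReal_le (hb x) a _).trans (mul_le_mul_of_nonneg_left (hM _) hc))
    (fun x a => (abs_mul_gaussianPDFReal_le (hb' x) a _).trans
      (mul_le_mul_of_nonneg_left (hM _) hc)) x
  have hg : HasDerivAt (fun x => gaussianPDFReal 0 v (y - F x a))
      (-((y - F x a) / v) * gaussianPDFReal 0 v (y - F x a) * -(F' x a)) x :=
    HasDerivAt.comp (h₂ := gaussianPDFReal 0 v) x (hasDerivAt_gaussianPDFReal v (y - F x a))
      ((hderiv x a).const_sub y)
  refine ((hweight x a).mul hg).congr_deriv ?_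
  ring

end HermiteChannel

lemma Pout_eq_channelDensity {p : ℕ} (PA : Measure (Fin p → ℝ)) {v : NNReal}
    {f : ℝ → (Fin p → ℝ) → ℝ} (y x : ℝ) :
    Pout PA v f y x = channelDensity PA v (f x) y := by
  simp only [Pout, channelDensity, channelAvg, gaussianPDFReal_def, sub_zero, one_mul]
  refine integral_congr_ae (ae_of_all _ fun a => ?_)
  simp only
  ring

section Score

variable {p : ℕ} (PA : Measure (Fin p → ℝ)) [IsProbabilityMeasure PA] {v : NNReal}
  {f : ℝ → (Fin p → ℝ) → ℝ} {K : ℝ}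

/-- Weight of the first `x`-derivative of the Gaussian density centred at `f x a`. -/
def scoreWeight (v : NNReal) (f : ℝ → (Fin p → ℝ) → ℝ) (x : ℝ) (a : Fin p → ℝ) : ℝ → ℝ :=
  hermiteWeight v (deriv (f · a) x / v) 0

/-- Weight of the second `x`-derivative of the Gaussian density centred at `f x a`. -/
def curvatureWeight (v : NNReal) (f : ℝ → (Fin p → ℝ) → ℝ) (x : ℝ) (a : Fin p → ℝ) : ℝ → ℝ :=
  hermiteWeight v (deriv (deriv (f · a)) x / v) (deriv (f · a) x ^ 2 / v ^ 2)

lemma hasDerivAt_of_contDiff_two {g : ℝ → ℝ} (hg : ContDiff ℝ 2 g) (x : ℝ) :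
    HasDerivAt g (deriv g x) x :=
  (hg.differentiable (by norm_num) x).hasDerivAt

lemma hasDerivAt_deriv_of_contDiff_two {g : ℝ → ℝ} (hg : ContDiff ℝ 2 g) (x : ℝ) :
    HasDerivAt (deriv g) (deriv (deriv g) x) x :=
  ((((contDiff_succ_iff_deriv (n := 1)).1 (by simpa [one_add_one_eq_two] using hg)).2.2
    ).differentiable (by norm_num) x).hasDerivAt

lemma measurable_deriv_param (hf : ∀ a, ContDiff ℝ 2 (f · a)) (hm : ∀ x, Measurable (f x))
    (x : ℝ) : Measurable fun a => deriv (f · a) x :=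
  measurable_of_hasDerivAt hm fun a => hasDerivAt_of_contDiff_two (hf a) x

lemma measurable_deriv_deriv_param (hf : ∀ a, ContDiff ℝ 2 (f · a)) (hm : ∀ x, Measurable (f x))
    (x : ℝ) : Measurable fun a => deriv (deriv (f · a)) x :=
  measurable_of_hasDerivAt (F := fun x a => deriv (f · a) x) (measurable_deriv_param hf hm)
    fun a => hasDerivAt_deriv_of_contDiff_two (hf a) x

lemma abs_deriv_div_le (hK : ∀ x a, |deriv (f · a) x| ≤ K ∧ |deriv (deriv (f · a)) x| ≤ K)
    (x : ℝ) (a : Fin p → ℝ) : |deriv (f · a) x / v| ≤ K / v + K ^ 2 / v ^ 2 := by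
  rw [abs_div, NNReal.abs_eq]
  have : |deriv (f · a) x| / v ≤ K / v := by gcongr; exact (hK x a).1
  have : 0 ≤ K ^ 2 / (v : ℝ) ^ 2 := by positivity
  linarith

lemma abs_deriv_deriv_div_le (hK : ∀ x a, |deriv (f · a) x| ≤ K ∧ |deriv (deriv (f · a)) x| ≤ K)
    (x : ℝ) (a : Fin p → ℝ) : |deriv (deriv (f · a)) x / v| ≤ K / v + K ^ 2 / v ^ 2 := by
  rw [abs_div, NNReal.abs_eq]
  have : |deriv (deriv (f · a)) x| / v ≤ K / v := by gcongr; exact (hK x a).2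
  have : 0 ≤ K ^ 2 / (v : ℝ) ^ 2 := by positivity
  linarith

lemma abs_deriv_sq_div_le (hK : ∀ x a, |deriv (f · a) x| ≤ K ∧ |deriv (deriv (f · a)) x| ≤ K)
    (x : ℝ) (a : Fin p → ℝ) : |deriv (f · a) x ^ 2 / v ^ 2| ≤ K / v + K ^ 2 / v ^ 2 := by
  have hK0 : 0 ≤ K := (abs_nonneg _).trans (hK x a).1
  rw [abs_of_nonneg (by positivity), ← sq_abs]
  have : |deriv (f · a) x| ^ 2 / (v : ℝ) ^ 2 ≤ K ^ 2 / v ^ 2 := by gcongr; exact (hK x a).1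
  have : 0 ≤ K / (v : ℝ) := by positivity
  linarith

lemma hasDerivAt_channelDensity (hf : ∀ a, ContDiff ℝ 2 (f · a))
    (hK : ∀ x a, |deriv (f · a) x| ≤ K ∧ |deriv (deriv (f · a)) x| ≤ K)
    (hm : ∀ x, Measurable (f x)) (y x : ℝ) :
    HasDerivAt (fun x => channelDensity PA v (f x) y)
      (channelAvg PA v (f x) (scoreWeight v f x) y) x := by
  have hB0 : |(0 : ℝ)| ≤ K / v + K ^ 2 / v ^ 2 := by
    simpa using (abs_nonneg _).trans (abs_deriv_div_le (v := v) hK 0 0)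
  refine hasDerivAt_channelAvg PA (h := fun _ _ _ => 1) (h' := scoreWeight v f) hm
    (fun x a => hasDerivAt_of_contDiff_two (hf a) x) (fun _ => measurable_const)
    (fun x a t => (abs_one_le_quartic t).trans ?_)
    (fun x a t => abs_hermiteWeight_le_quartic v (abs_deriv_div_le hK x a) hB0 t) y
    (fun x a => (hasDerivAt_const x (1 : ℝ)).congr_deriv ?_) x
  · gcongr
    have : 0 ≤ 2 * (K / v + K ^ 2 / (v : ℝ) ^ 2) ^ 2 * (2 + (v : ℝ) ^ 2) := by positivity
    linarith
  · simp only [scoreWeight, hermiteWeight]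
    ring

lemma hasDerivAt_channelAvg_scoreWeight (hv : v ≠ 0) (hf : ∀ a, ContDiff ℝ 2 (f · a))
    (hK : ∀ x a, |deriv (f · a) x| ≤ K ∧ |deriv (deriv (f · a)) x| ≤ K)
    (hm : ∀ x, Measurable (f x)) (y x : ℝ) :
    HasDerivAt (fun x => channelAvg PA v (f x) (scoreWeight v f x) y)
      (channelAvg PA v (f x) (curvatureWeight v f x) y) x := by
  have hB0 : |(0 : ℝ)| ≤ K / v + K ^ 2 / v ^ 2 := by
    simpa using (abs_nonneg _).trans (abs_deriv_div_le (v := v) hK 0 0)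
  have hv' : (v : ℝ) ≠ 0 := by simpa using hv
  refine hasDerivAt_channelAvg PA (h := scoreWeight v f) (h' := curvatureWeight v f) hm
    (fun x a => hasDerivAt_of_contDiff_two (hf a) x)
    (fun x => measurable_hermiteWeight ((measurable_deriv_param hf hm x).div_const _)
      measurable_const)
    (fun x a t => abs_hermiteWeight_le_quartic v (abs_deriv_div_le hK x a) hB0 t)
    (fun x a t => abs_hermiteWeight_le_quartic v (abs_deriv_deriv_div_le hK x a)
      (abs_deriv_sq_div_le hK x a) t) y (fun x a => ?_) x
  have h1 := ((hasDerivAt_deriv_of_contDiff_two (hf a) x).div_const (v : ℝ)).mul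
    ((hasDerivAt_of_contDiff_two (hf a) x).const_sub y)
  simp only [scoreWeight, curvatureWeight, hermiteWeight, zero_mul, zero_add]
  refine h1.congr_deriv ?_
  field_simp
  ring

lemma hasDerivAt_log_Pout (hv : v ≠ 0) (hf : ∀ a, ContDiff ℝ 2 (f · a))
    (hK : ∀ x a, |deriv (f · a) x| ≤ K ∧ |deriv (deriv (f · a)) x| ≤ K)
    (hm : ∀ x, Measurable (f x)) (y x : ℝ) :
    HasDerivAt (fun x => Real.log (Pout PA v f y x))
      (channelAvg PA v (f x) (scoreWeight v f x) y / channelDensity PA v (f x) y) x := by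
  simp only [Pout_eq_channelDensity]
  exact (hasDerivAt_channelDensity PA hf hK hm y x).log (channelDensity_pos PA hv (hm x) y).ne'

lemma uD1_eq_ratio (hv : v ≠ 0) (hf : ∀ a, ContDiff ℝ 2 (f · a))
    (hK : ∀ x a, |deriv (f · a) x| ≤ K ∧ |deriv (deriv (f · a)) x| ≤ K)
    (hm : ∀ x, Measurable (f x)) (y x : ℝ) :
    uD1 PA v f y x =
      channelAvg PA v (f x) (scoreWeight v f x) y / channelDensity PA v (f x) y :=
  (hasDerivAt_log_Pout PA hv hf hK hm y x).deriv

lemma uD2_add_sq_eq_ratio (hv : v ≠ 0) (hf : ∀ a, ContDiff ℝ 2 (f · a))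
    (hK : ∀ x a, |deriv (f · a) x| ≤ K ∧ |deriv (deriv (f · a)) x| ≤ K)
    (hm : ∀ x, Measurable (f x)) (y x : ℝ) :
    uD2 PA v f y x + uD1 PA v f y x ^ 2 =
      channelAvg PA v (f x) (curvatureWeight v f x) y / channelDensity PA v (f x) y := by
  have hpos := (channelDensity_pos PA hv (hm x) y).ne'
  have hd : deriv (fun x => Real.log (Pout PA v f y x)) = fun x =>
      channelAvg PA v (f x) (scoreWeight v f x) y / channelDensity PA v (f x) y :=
    funext fun x => (hasDerivAt_log_Pout PA hv hf hK hm y x).deriv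
  rw [uD1_eq_ratio PA hv hf hK hm, uD2, hd,
    ((hasDerivAt_channelAvg_scoreWeight PA hv hf hK hm y x).fun_div
      (hasDerivAt_channelDensity PA hf hK hm y x) hpos).deriv]
  field_simp
  ring

/-- Centred with second moment at most `D`. -/
def CentredSqBound {Ω : Type*} [MeasurableSpace Ω] (ρ : Measure Ω) (D : ℝ) (R : Ω → ℝ) : Prop :=
  ∫ ω, R ω ∂ρ = 0 ∧ ∫ ω, R ω ^ 2 ∂ρ ≤ D

lemma exists_centredSqBound_score (hv : v ≠ 0) (hf : ∀ a, ContDiff ℝ 2 (f · a))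
    (hK : ∀ x a, |deriv (f · a) x| ≤ K ∧ |deriv (deriv (f · a)) x| ≤ K)
    (hm : ∀ x, Measurable (f x)) :
    ∃ D, 1 ≤ D ∧ ∀ x,
      CentredSqBound (PA.prod stdG) D (fun ω => uD1 PA v f (f x ω.1 + √v * ω.2) x) ∧
      CentredSqBound (PA.prod stdG) D (fun ω => uD2 PA v f (f x ω.1 + √v * ω.2) x +
        uD1 PA v f (f x ω.1 + √v * ω.2) x ^ 2) := by
  have hB0 : |(0 : ℝ)| ≤ K / v + K ^ 2 / v ^ 2 := by
    simpa using (abs_nonneg _).trans (abs_deriv_div_le (v := v) hK 0 0)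
  refine ⟨max 1 (2 * (K / v + K ^ 2 / v ^ 2) ^ 2 *
    ∫ t : ℝ, ((t ^ 2 - v) ^ 2 + t ^ 2) ∂(gaussianReal 0 v)), le_max_left _ _, fun x => ?_⟩
  have m₁ := (measurable_deriv_param hf hm x).div_const (v : ℝ)
  have m₂ := (measurable_deriv_deriv_param hf hm x).div_const (v : ℝ)
  have m₃ := ((measurable_deriv_param hf hm x).pow_const 2).div_const ((v : ℝ) ^ 2)
  simp only [CentredSqBound, uD2_add_sq_eq_ratio PA hv hf hK hm]
  simp only [uD1_eq_ratio PA hv hf hK hm]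
  refine ⟨⟨?_, ?_⟩, ?_, ?_⟩
  · exact integral_hermite_ratio PA hv (hm x) m₁ measurable_const (abs_deriv_div_le hK x)
      fun _ => hB0
  · exact (integral_hermite_ratio_sq_le PA hv (hm x) m₁ measurable_const (abs_deriv_div_le hK x)
      fun _ => hB0).trans (le_max_right _ _)
  · exact integral_hermite_ratio PA hv (hm x) m₂ m₃ (abs_deriv_deriv_div_le hK x)
      (abs_deriv_sq_div_le hK x)
  · exact (integral_hermite_ratio_sq_le PA hv (hm x) m₂ m₃ (abs_deriv_deriv_div_le hK x)
      (abs_deriv_sq_div_le hK x)).trans (le_max_right _ _)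

end Score

section Independence

variable {Ω : Type*} [MeasurableSpace Ω] (ρ : Measure Ω) [IsProbabilityMeasure ρ] {n : ℕ}

lemma integral_pi_finset_prod (s : Finset (Fin n)) (G : Fin n → Ω → ℝ) :
    ∫ ω, ∏ i ∈ s, G i (ω i) ∂(Measure.pi fun _ : Fin n => ρ) = ∏ i ∈ s, ∫ x, G i x ∂ρ := by
  have h := integral_fintype_prod_eq_prod (μ := fun _ : Fin n => ρ)
    (fun i x => if i ∈ s then G i x else 1)
  simp only [Finset.prod_ite_mem, Finset.univ_inter] at h
  rw [h, ← Finset.prod_subset s.subset_univ]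
  · exact Finset.prod_congr rfl fun i hi => by simp [hi]
  · intro i _ hi
    simp [hi]

variable {ρ}

lemma CentredSqBound.prod_coord {D : ℝ} (hD : 1 ≤ D) {R : Fin n → Ω → ℝ}
    (hR : ∀ i, CentredSqBound ρ D (R i)) {s : Finset (Fin n)} (hs : s.Nonempty) {k : ℕ}
    (hk : s.card ≤ k) {X : (Fin n → Ω) → ℝ} (hX : ∀ ω, X ω = ∏ i ∈ s, R i (ω i)) :
    CentredSqBound (Measure.pi fun _ : Fin n => ρ) (D ^ k) X := by
  obtain rfl : X = fun ω => ∏ i ∈ s, R i (ω i) := funext hX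
  constructor
  · obtain ⟨i, hi⟩ := hs
    rw [integral_pi_finset_prod]
    exact Finset.prod_eq_zero hi (hR i).1
  · simp only [← Finset.prod_pow]
    rw [integral_pi_finset_prod ρ s fun i x => R i x ^ 2]
    calc _ ≤ ∏ _i ∈ s, D :=
          Finset.prod_le_prod (fun i _ => integral_nonneg fun x => sq_nonneg _)
            fun i _ => (hR i).2
      _ = D ^ s.card := by simp
      _ ≤ D ^ k := pow_le_pow_right₀ hD hk

end Independence


/-- **Lemma D.2 (Properties of the output kernel).** Conditionally on the signals
`S_μ` (formalised as arbitrary deterministic values), `E[u′_μ] = 0`, `E[U_{μν}] = 0`,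
`E[U_{μνη}] = 0` for `μ ≠ ν`, and the corresponding second moments are bounded by
constants depending only on `f`. -/
theorem output_kernel_properties
    (p : ℕ) (PA : Measure (Fin p → ℝ)) [IsProbabilityMeasure PA]
    (Δ : ℝ) (hΔ : 0 < Δ)
    (f : ℝ → (Fin p → ℝ) → ℝ)
    (hfC2 : ∀ A, ContDiff ℝ 2 (fun x => f x A))
    (hfbd : ∃ K, ∀ x A, |deriv (fun x' => f x' A) x| ≤ K ∧
      |deriv (deriv (fun x' => f x' A)) x| ≤ K)
    (hfmeas : Measurable (Function.uncurry f)) :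
    ∃ C > 0, ∃ C' > 0, ∀ n : ℕ, ∀ S : Fin n → ℝ, ∀ μ ν η : Fin n,
      (∫ ωc, uP PA Δ f S ωc μ ∂(chanMeasure p PA n) = 0) ∧
      (∫ ωc, Upair PA Δ f S ωc μ ν ∂(chanMeasure p PA n) = 0) ∧
      (μ ≠ ν → ∫ ωc, Utriple PA Δ f S ωc μ ν η ∂(chanMeasure p PA n) = 0) ∧
      (∫ ωc, (uP PA Δ f S ωc μ) ^ 2 ∂(chanMeasure p PA n) ≤ C) ∧
      (∫ ωc, (Upair PA Δ f S ωc μ ν) ^ 2 ∂(chanMeasure p PA n) ≤ C) ∧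
      (μ ≠ ν → ∫ ωc, (Utriple PA Δ f S ωc μ ν η) ^ 2 ∂(chanMeasure p PA n) ≤ C') := by
  obtain ⟨K, hK⟩ := hfbd
  lift Δ to NNReal using hΔ.le
  have hv : Δ ≠ 0 := by simpa using hΔ.ne'
  obtain ⟨D, hD, hR⟩ := exists_centredSqBound_score PA hv hfC2 hK
    fun x => hfmeas.comp measurable_prodMk_left
  have : IsProbabilityMeasure stdG := by unfold stdG; infer_instance
  have hD3 : 0 < D ^ 3 := by positivity
  refine ⟨D ^ 3, hD3, D ^ 3, hD3, fun n S μ ν η => ?_⟩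
  let R₁ (i : Fin n) (ω : (Fin p → ℝ) × ℝ) : ℝ := uD1 PA Δ f (f (S i) ω.1 + √Δ * ω.2) (S i)
  let R₂ (i : Fin n) (ω : (Fin p → ℝ) × ℝ) : ℝ :=
    uD2 PA Δ f (f (S i) ω.1 + √Δ * ω.2) (S i) + R₁ i ω ^ 2
  have hR₁ (i : Fin n) : CentredSqBound (PA.prod stdG) D (R₁ i) := (hR (S i)).1
  have hR₂ (i : Fin n) : CentredSqBound (PA.prod stdG) D (R₂ i) := (hR (S i)).2
  have hmix (j i : Fin n) : CentredSqBound (PA.prod stdG) D (if i = j then R₂ i else R₁ i) := by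
    split_ifs
    exacts [hR₂ i, hR₁ i]
  have hU : CentredSqBound (chanMeasure p PA n) (D ^ 3) (fun ωc => uP PA Δ f S ωc μ) :=
    CentredSqBound.prod_coord hD hR₁ (Finset.singleton_nonempty μ) (by simp) fun ωc => by
      simp [uP, Ych, R₁]
  have hUU : CentredSqBound (chanMeasure p PA n) (D ^ 3) (fun ωc => Upair PA Δ f S ωc μ ν) := by
    by_cases hμν : μ = ν
    · subst hμν
      refine CentredSqBound.prod_coord hD hR₂ (Finset.singleton_nonempty μ) (by simp) fun ωc => ?_
      simp [Upair, uP, uPP, Ych, R₁, R₂, kd, sq]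
    · refine CentredSqBound.prod_coord hD hR₁ (s := {μ, ν}) (by simp)
        (Finset.card_le_two.trans (by norm_num)) fun ωc => ?_
      simp [Upair, uP, Ych, R₁, kd, hμν]
  have hUUU (hμν : μ ≠ ν) :
      CentredSqBound (chanMeasure p PA n) (D ^ 3) (fun ωc => Utriple PA Δ f S ωc μ ν η) := by
    by_cases hμη : μ = η
    · subst hμη
      refine CentredSqBound.prod_coord hD (hmix μ) (s := {μ, ν}) (by simp)
        (Finset.card_le_two.trans (by norm_num)) fun ωc => ?_
      simp [Utriple, uP, uPP, Ych, R₁, R₂, kd, hμν, hμν.symm]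
      ring
    by_cases hνη : ν = η
    · subst hνη
      refine CentredSqBound.prod_coord hD (hmix ν) (s := {μ, ν}) (by simp)
        (Finset.card_le_two.trans (by norm_num)) fun ωc => ?_
      simp [Utriple, uP, uPP, Ych, R₁, R₂, kd, hμν]
      ring
    · refine CentredSqBound.prod_coord hD hR₁ (s := {μ, ν, η}) (by simp) Finset.card_le_three
        fun ωc => ?_
      simp [Utriple, uP, Ych, R₁, kd, hμν, hμη, hνη]
      ring
  exact ⟨hU.1, hUU.1, fun hμν => (hUUU hμν).1, hU.2, hUU.2, fun hμν => (hUUU hμν).2⟩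

end
end
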